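/- arXiv:2308.15082 — 4 statements merged into one kernel-verified Lean document; each statement's English description precedes it below -/
import Mathlib

section
/- Let H and U be separable complex Hilbert spaces, A : H → H and B : U → H bounded linear operators. Assume that for every α > 0 there exist closed subspaces Q₁ and Q₂ of H such that: (b₁) every x ∈ H has a unique decomposition x = x₁ + x₂ with x₁ ∈ Q₁, x₂ ∈ Q₂; (b₂) exp(tA*)Q₁ ⊆ Q₁ and exp(tA*)Q₂ ⊆ Q₂ for every t ≥ 0; (b₃) the spectrum of the restriction of A* to Q₁ (a bounded operator on the Hilbert space Q₁) is contained in {z ∈ ℂ : Re z > −α}; (b₄) there exist M > 0 and δ > 0 with ‖exp(tA*)x‖ ≤ M·e^{−δt}·‖x‖ for all x ∈ Q₂ and t ≥ 0. Then the system [A,B] is exponentially stabilizable if and only if the pair (A*,B*) satisfies (HESI)_β for some β > 0. -/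
open ContinuousLinearMap in
/-- On a nontrivial complex Banach space, some translate `lam - T` of a bounded operator is not
surjective. -/
lemma exists_not_surjective_smul_sub {E : Type*} [NormedAddCommGroup E] [NormedSpace ℂ E]
    [CompleteSpace E] [Nontrivial E] (T : E →L[ℂ] E) :
    ∃ lam : ℂ, ¬ Function.Surjective (fun x : E => lam • x - T x) := by
  by_contra! hsurj
  have hcoe : ∀ lam : ℂ, ⇑(algebraMap ℂ (E →L[ℂ] E) lam - T) = fun x : E => lam • x - T x := by
    intro lam
    ext x
    simp [Algebra.algebraMap_eq_smul_one]
  have hclosed : IsClosed (resolventSet ℂ T) := by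
    refine isClosed_of_closure_subset fun lam hlam => ?_
    have hs : Function.Surjective ⇑(algebraMap ℂ (E →L[ℂ] E) lam - T) := by
      rw [hcoe]; exact hsurj lam
    obtain ⟨C, hC, hpre⟩ := exists_preimage_norm_le _ hs
    obtain ⟨μ, hμ, hdist⟩ := Metric.mem_closure_iff.1 hlam (1 / (4 * C)) (by positivity)
    set δ := ‖lam - μ‖ with hδ
    rw [dist_eq_norm, ← hδ, lt_div_iff₀ (by positivity)] at hdist
    obtain ⟨u, hu⟩ : IsUnit (algebraMap ℂ (E →L[ℂ] E) μ - T) := hμ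
    set J : E →L[ℂ] E := ↑u⁻¹ with hJ
    have hJu : ∀ x, J (μ • x - T x) = x := by
      intro x
      have h1 := congrArg (fun S : E →L[ℂ] E => S x) u.inv_mul
      have h2 : (u : E →L[ℂ] E) x = μ • x - T x := by rw [hu, hcoe]
      rw [← h2]
      exact h1
    have hJn : ‖J‖ ≤ 2 * C := by
      have h1 : ‖J‖ ≤ C + δ * C * ‖J‖ := by
        refine opNorm_le_bound _ (by positivity) fun y => ?_
        obtain ⟨x, hx, hxn⟩ := hpre y
        rw [hcoe] at hx
        have h2 : J y = x + (lam - μ) • J x := by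
          have h3 : y = (μ • x - T x) + (lam - μ) • x := by
            rw [← hx]; module
          rw [h3, map_add, hJu, map_smul]
        calc ‖J y‖ ≤ ‖x‖ + δ * ‖J x‖ := by
              rw [h2, hδ, ← norm_smul]; exact norm_add_le _ _
          _ ≤ ‖x‖ + δ * (‖J‖ * ‖x‖) := by gcongr; exact J.le_opNorm x
          _ = (1 + δ * ‖J‖) * ‖x‖ := by ring
          _ ≤ (1 + δ * ‖J‖) * (C * ‖y‖) := by gcongr
          _ = (C + δ * C * ‖J‖) * ‖y‖ := by ring
      nlinarith [norm_nonneg J, norm_nonneg (lam - μ)]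
    refine isUnit_iff_bijective.2 ⟨(injective_iff_map_eq_zero _).2 fun x hx => ?_, hs⟩
    rw [hcoe] at hx
    have h1 : x = (μ - lam) • J x := by
      rw [← map_smul]
      nth_rewrite 1 [← hJu x]
      congr 1
      rw [sub_smul, sub_eq_zero.1 hx]
    have h2 : ‖x‖ ≤ δ * (‖J‖ * ‖x‖) := by
      calc ‖x‖ = δ * ‖J x‖ := by nth_rewrite 1 [h1]; rw [norm_smul, norm_sub_rev]
        _ ≤ _ := by gcongr; exact J.le_opNorm x
    by_contra hne
    have hpos := norm_pos_iff.2 hne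
    have : δ * ‖J‖ ≤ δ * (2 * C) := by gcongr
    nlinarith
  have huniv : resolventSet ℂ T = Set.univ := by
    refine IsClopen.eq_univ ⟨hclosed, spectrum.isOpen_resolventSet T⟩ ?_
    exact ⟨((‖T‖ + 1 : ℝ) : ℂ), spectrum.mem_resolventSet_of_norm_lt (by
      rw [Complex.norm_real, Real.norm_of_nonneg (by positivity)]; linarith)⟩
  obtain ⟨z, hz⟩ := spectrum.nonempty T
  exact hz (huniv ▸ Set.mem_univ z)

open ContinuousLinearMap in
/-- A bounded operator `R` and an observation `D` satisfying the pointwise Hautus condition at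
every complex number satisfy a finite Kalman observability inequality. -/
lemma exists_kalman_of_hautus {X U : Type*} [NormedAddCommGroup X] [InnerProductSpace ℂ X]
    [CompleteSpace X] [NormedAddCommGroup U] [InnerProductSpace ℂ U] [CompleteSpace U]
    (R : X →L[ℂ] X) (D : X →L[ℂ] U)
    (h : ∀ μ : ℂ, ∃ c : ℝ, 0 < c ∧ ∀ y : X, c * ‖y‖ ^ 2 ≤ ‖μ • y - R y‖ ^ 2 + ‖D y‖ ^ 2) :
    ∃ (n : ℕ) (c : ℝ), 0 < c ∧
      ∀ y : X, c * ‖y‖ ^ 2 ≤ ∑ k ∈ Finset.range n, ‖D ((R ^ k) y)‖ ^ 2 := by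
  let I : Submodule ℂ (X →L[ℂ] X) :=
    { carrier := {S | ∃ (n : ℕ) (C : ℝ), 0 ≤ C ∧
        ∀ y, ‖S y‖ ≤ C * ∑ k ∈ Finset.range n, ‖D ((R ^ k) y)‖}
      zero_mem' := ⟨0, 0, le_rfl, by simp⟩
      add_mem' := by
        rintro S₁ S₂ ⟨n₁, C₁, hC₁, h₁⟩ ⟨n₂, C₂, hC₂, h₂⟩
        refine ⟨max n₁ n₂, C₁ + C₂, by positivity, fun y => ?_⟩
        have hmono : ∀ m ≤ max n₁ n₂, ∑ k ∈ Finset.range m, ‖D ((R ^ k) y)‖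
            ≤ ∑ k ∈ Finset.range (max n₁ n₂), ‖D ((R ^ k) y)‖ := fun m hm =>
          Finset.sum_le_sum_of_subset_of_nonneg (Finset.range_subset_range.2 hm)
            fun _ _ _ => norm_nonneg _
        calc ‖(S₁ + S₂) y‖ ≤ ‖S₁ y‖ + ‖S₂ y‖ := norm_add_le _ _
          _ ≤ _ := add_le_add (h₁ y) (h₂ y)
          _ ≤ _ := add_le_add (mul_le_mul_of_nonneg_left (hmono n₁ (le_max_left _ _)) hC₁)
              (mul_le_mul_of_nonneg_left (hmono n₂ (le_max_right _ _)) hC₂)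
          _ = _ := by ring
      smul_mem' := by
        rintro z S ⟨n, C, hC, hS⟩
        refine ⟨n, ‖z‖ * C, by positivity, fun y => ?_⟩
        rw [smul_apply, norm_smul, mul_assoc]
        exact mul_le_mul_of_nonneg_left (hS y) (norm_nonneg _) }
  have hleft : ∀ Y S : X →L[ℂ] X, S ∈ I → Y * S ∈ I := by
    rintro Y S ⟨n, C, hC, hS⟩
    refine ⟨n, ‖Y‖ * C, by positivity, fun y => ?_⟩
    rw [mul_assoc]
    exact (Y.le_opNorm _).trans (mul_le_mul_of_nonneg_left (hS y) (norm_nonneg _))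
  have hright : ∀ S : X →L[ℂ] X, S ∈ I → S * R ∈ I := by
    rintro S ⟨n, C, hC, hS⟩
    refine ⟨n + 1, C, hC, fun y => (hS (R y)).trans (mul_le_mul_of_nonneg_left ?_ hC)⟩
    rw [Finset.sum_range_succ']
    simp only [pow_succ, mul_apply_eq_comp]
    exact le_add_of_nonneg_right (norm_nonneg _)
  have hobs : ∀ Z : U →L[ℂ] X, Z ∘L D ∈ I := fun Z =>
    ⟨1, ‖Z‖, norm_nonneg _, fun y => by simpa using Z.le_opNorm (D y)⟩
  have hone : (1 : X →L[ℂ] X) ∈ I.topologicalClosure := by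
    by_contra hnot
    set J := I.topologicalClosure with hJ
    have : IsClosed (J : Set (X →L[ℂ] X)) := I.isClosed_topologicalClosure
    have : Nontrivial ((X →L[ℂ] X) ⧸ J) :=
      ⟨J.mkQ 1, 0, fun h0 => hnot ((Submodule.Quotient.mk_eq_zero J).1 h0)⟩
    let ρ : (X →L[ℂ] X) →L[ℂ] (X →L[ℂ] X) := (ContinuousLinearMap.mul ℂ (X →L[ℂ] X)).flip R
    have hIJ : J ≤ J.comap ρ.toLinearMap := by
      refine I.topologicalClosure_minimal (fun S hS => ?_)
        (IsClosed.preimage ρ.continuous I.isClosed_topologicalClosure)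
      exact I.le_topologicalClosure (hright S hS)
    let T : ((X →L[ℂ] X) ⧸ J) →L[ℂ] ((X →L[ℂ] X) ⧸ J) := J.liftQL (J.mkQL ∘L ρ) (by
      intro S hS
      have := hIJ hS
      simpa using this)
    obtain ⟨lam, hlam⟩ := exists_not_surjective_smul_sub T
    refine hlam fun q => ?_
    obtain ⟨S, rfl⟩ := J.mkQ_surjective q
    obtain ⟨c, hc, hcoer⟩ := h lam
    set N : X →L[ℂ] X := lam • 1 - R with hN
    have hunit : IsUnit (adjoint N ∘L N + adjoint D ∘L D) := by
      refine isUnit_of_forall_le_norm_inner_map (𝕜 := ℂ) _ (c := ⟨c, hc.le⟩) hc fun y => ?_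
      have h1 : inner ℂ ((adjoint N ∘L N + adjoint D ∘L D) y) y
          = ((‖N y‖ ^ 2 + ‖D y‖ ^ 2 : ℝ) : ℂ) := by
        simp [add_apply, comp_apply, adjoint_inner_left, inner_self_eq_norm_sq_to_K]
      rw [h1, Complex.norm_real, Real.norm_of_nonneg (by positivity), mul_comm]
      exact hcoer y
    obtain ⟨P, hP⟩ := hunit
    set V : X →L[ℂ] X := S * (↑P⁻¹ : X →L[ℂ] X) with hV
    refine ⟨J.mkQ (V * adjoint N), ?_⟩
    have hdecomp : V * adjoint N * N + (V ∘L adjoint D) ∘L D = S := by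
      have h1 : V * (adjoint N ∘L N + adjoint D ∘L D) = S := by
        rw [← hP, hV, mul_assoc, P.inv_mul, mul_one]
      nth_rewrite 1 [← h1]
      ext y
      simp
    have hmem : (V ∘L adjoint D) ∘L D ∈ J := I.le_topologicalClosure (hobs _)
    have hT : T (J.mkQ (V * adjoint N)) = J.mkQ (V * adjoint N * R) := rfl
    have hN' : lam • (V * adjoint N) - V * adjoint N * R = V * adjoint N * N := by
      rw [hN, mul_sub, mul_smul_comm, mul_one]
    change lam • J.mkQ (V * adjoint N) - T (J.mkQ (V * adjoint N)) = J.mkQ S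
    rw [hT, ← map_smul, ← map_sub, hN', ← sub_eq_zero, ← map_sub, Submodule.mkQ_apply,
      Submodule.Quotient.mk_eq_zero]
    nth_rewrite 1 [← hdecomp]
    rw [sub_add_cancel_left]
    exact J.neg_mem hmem
  obtain ⟨S, hS, hdist⟩ := Metric.mem_closure_iff.1 hone 1 one_pos
  obtain ⟨P, hP⟩ : IsUnit S := by
    have := isUnit_one_sub_of_norm_lt_one (x := 1 - S) (by rwa [← dist_eq_norm])
    simpa using this
  have hmem : (1 : X →L[ℂ] X) ∈ I := by
    have := hleft ↑P⁻¹ S hS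
    rwa [← hP, P.inv_mul] at this
  obtain ⟨n, C, hC, hbd⟩ := hmem
  refine ⟨n, 1 / (C ^ 2 * n + 1), by positivity, fun y => ?_⟩
  have h1 : ‖y‖ ^ 2 ≤ C ^ 2 * (∑ k ∈ Finset.range n, ‖D ((R ^ k) y)‖) ^ 2 := by
    rw [← mul_pow]
    exact pow_le_pow_left₀ (norm_nonneg _) (hbd y) 2
  have h2 := sq_sum_le_card_mul_sum_sq (s := Finset.range n) (f := fun k => ‖D ((R ^ k) y)‖)
  rw [Finset.card_range] at h2
  have h3 : 0 ≤ ∑ k ∈ Finset.range n, ‖D ((R ^ k) y)‖ ^ 2 := by positivity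
  rw [div_mul_eq_mul_div, one_mul, div_le_iff₀ (by positivity)]
  nlinarith [mul_le_mul_of_nonneg_left h2 (sq_nonneg C)]

/-- The derivative of an orbit `t ↦ exp (t F) x`, with the generator on the left. -/
lemma hasDerivAt_exp_smul_apply {E : Type*} [NormedAddCommGroup E] [NormedSpace ℂ E]
    [CompleteSpace E] (F : E →L[ℂ] E) (x : E) (t : ℝ) :
    HasDerivAt (fun t : ℝ => NormedSpace.exp (t • F) x) (F (NormedSpace.exp (t • F) x)) t :=
  (((ContinuousLinearMap.apply ℂ E x).restrictScalars ℝ).hasFDerivAt.comp_hasDerivAt t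
    (hasDerivAt_exp_smul_const' (𝕂 := ℝ) F t))

/-- The derivative of an orbit `t ↦ exp (t F) x`, with the generator on the right. -/
lemma hasDerivAt_exp_smul_apply' {E : Type*} [NormedAddCommGroup E] [NormedSpace ℂ E]
    [CompleteSpace E] (F : E →L[ℂ] E) (x : E) (t : ℝ) :
    HasDerivAt (fun t : ℝ => NormedSpace.exp (t • F) x) (NormedSpace.exp (t • F) (F x)) t :=
  (((ContinuousLinearMap.apply ℂ E x).restrictScalars ℝ).hasFDerivAt.comp_hasDerivAt t
    (hasDerivAt_exp_smul_const (𝕂 := ℝ) F t))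

/-- An operator intertwining two generators intertwines their exponentials. -/
lemma exp_smul_apply_of_intertwine {E F : Type*} [NormedAddCommGroup E] [NormedSpace ℂ E]
    [CompleteSpace E] [NormedAddCommGroup F] [NormedSpace ℂ F] [CompleteSpace F]
    (i : E →L[ℂ] F) (G₁ : E →L[ℂ] E) (G : F →L[ℂ] F) (h : ∀ x, G (i x) = i (G₁ x))
    (t : ℝ) (x : E) :
    NormedSpace.exp (t • G) (i x) = i (NormedSpace.exp (t • G₁) x) := by
  have hpow : ∀ (n : ℕ) (x : E), (G ^ n) (i x) = i ((G₁ ^ n) x) := by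
    intro n
    induction n with
    | zero => simp
    | succ n ih => intro x; simp [pow_succ, h, ih]
  have h1 := (NormedSpace.exp_series_hasSum_exp' (𝕂 := ℝ) (t • G)).mapL
    ((ContinuousLinearMap.apply ℂ F (i x)).restrictScalars ℝ)
  have h2 := (NormedSpace.exp_series_hasSum_exp' (𝕂 := ℝ) (t • G₁)).mapL
    ((i ∘L ContinuousLinearMap.apply ℂ E x).restrictScalars ℝ)
  refine h1.unique ?_
  convert h2 using 2 with n
  · simp [smul_pow, hpow]
  · rfl

/-- A coercive quadratic Lyapunov function gives exponential decay. -/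
lemma norm_exp_smul_apply_le_of_lyapunov {X : Type*} [NormedAddCommGroup X]
    [InnerProductSpace ℂ X] [CompleteSpace X] (G W : X →L[ℂ] X)
    (hsymm : ∀ x y, inner ℂ (W x) y = inner ℂ x (W y)) {c : ℝ} (hc : 0 < c)
    (hcoer : ∀ x, c * ‖x‖ ^ 2 ≤ (inner ℂ (W x) x).re)
    (hdiss : ∀ x, 2 * (inner ℂ (W x) (G x)).re ≤ -(inner ℂ (W x) x).re) :
    ∃ M : ℝ, 0 < M ∧ ∀ t : ℝ, 0 ≤ t → ∀ x,
      ‖NormedSpace.exp (t • G) x‖ ≤ M * Real.exp (-(1 / 2) * t) * ‖x‖ := by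
  refine ⟨√((‖W‖ + 1) / c), by positivity, fun t ht x => ?_⟩
  set y : ℝ → X := fun t => NormedSpace.exp (t • G) x with hy
  have hyd : ∀ t, HasDerivAt y (G (y t)) t := hasDerivAt_exp_smul_apply G x
  have hWd : ∀ t, HasDerivAt (fun t => W (y t)) (W (G (y t))) t := fun t =>
    (W.restrictScalars ℝ).hasFDerivAt.comp_hasDerivAt t (hyd t)
  have hVd : ∀ t, HasDerivAt (fun t => (inner ℂ (W (y t)) (y t)).re)
      (inner ℂ (W (y t)) (G (y t)) + inner ℂ (W (G (y t))) (y t)).re t := fun t =>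
    Complex.reCLM.hasFDerivAt.comp_hasDerivAt t ((hWd t).inner ℂ (hyd t))
  have hanti : Antitone fun t => Real.exp t * (inner ℂ (W (y t)) (y t)).re := by
    refine antitone_of_hasDerivAt_nonpos
      (fun t => (Real.hasDerivAt_exp t).mul (hVd t)) fun t => ?_
    have h1 : (inner ℂ (W (G (y t))) (y t)).re = (inner ℂ (W (y t)) (G (y t))).re := by
      rw [hsymm, ← inner_conj_symm, Complex.conj_re]
    have h2 := hdiss (y t)
    simp only [Pi.zero_apply, Complex.add_re, h1]
    nlinarith [Real.exp_pos t]
  have h0 := hanti ht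
  have hy0 : y 0 = x := by simp [hy]
  simp only [hy0, Real.exp_zero, one_mul] at h0
  have h1 : (inner ℂ (W x) x).re ≤ ‖W‖ * ‖x‖ ^ 2 := by
    calc (inner ℂ (W x) x).re ≤ ‖inner ℂ (W x) x‖ := Complex.re_le_norm _
      _ ≤ ‖W x‖ * ‖x‖ := norm_inner_le_norm _ _
      _ ≤ ‖W‖ * ‖x‖ * ‖x‖ := by gcongr; exact W.le_opNorm x
      _ = _ := by ring
  have h2 : Real.exp t * (c * ‖y t‖ ^ 2) ≤ (‖W‖ + 1) * ‖x‖ ^ 2 :=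
    calc _ ≤ Real.exp t * (inner ℂ (W (y t)) (y t)).re := by gcongr; exact hcoer _
      _ ≤ ‖W‖ * ‖x‖ ^ 2 := h0.trans h1
      _ ≤ _ := by gcongr; linarith
  refine (sq_le_sq₀ (norm_nonneg _) (by positivity)).1 ?_
  have h3 : Real.exp (-(1 / 2) * t) ^ 2 = (Real.exp t)⁻¹ := by
    rw [← Real.exp_nat_mul, ← Real.exp_neg]; congr 1; push_cast; ring
  rw [mul_pow, mul_pow, Real.sq_sqrt (by positivity), h3]
  change ‖y t‖ ^ 2 ≤ _
  have he := Real.exp_pos t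
  field_simp
  linarith

/-- Perturbation of a decaying orbit by an operator whose range consists of decaying vectors. -/
lemma norm_exp_smul_apply_le_of_perturbation {E : Type*} [NormedAddCommGroup E] [NormedSpace ℂ E]
    [CompleteSpace E] (F G : E →L[ℂ] E) {M₁ M₂ μ : ℝ} (hM₁ : 0 ≤ M₁)
    (hG : ∀ t : ℝ, 0 ≤ t → ∀ y, ‖NormedSpace.exp (t • G) ((G - F) y)‖
      ≤ M₁ * Real.exp (-μ * t) * ‖(G - F) y‖) (x : E)
    (hF : ∀ t : ℝ, 0 ≤ t → ‖NormedSpace.exp (t • F) x‖ ≤ M₂ * Real.exp (-μ * t) * ‖x‖)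
    {t : ℝ} (ht : 0 ≤ t) :
    ‖NormedSpace.exp (t • G) x‖
      ≤ M₂ * (1 + M₁ * ‖G - F‖ * t) * Real.exp (-μ * t) * ‖x‖ := by
  have hd : ∀ s : ℝ, HasDerivAt
      (fun s : ℝ => NormedSpace.exp ((t - s) • G) (NormedSpace.exp (s • F) x))
      (-(NormedSpace.exp ((t - s) • G) ((G - F) (NormedSpace.exp (s • F) x)))) s := by
    intro s
    have h1 : HasDerivAt (fun s : ℝ => NormedSpace.exp ((t - s) • G))
        ((-1 : ℝ) • (NormedSpace.exp ((t - s) • G) * G)) s :=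
      (hasDerivAt_exp_smul_const (𝕂 := ℝ) G (t - s)).scomp s ((hasDerivAt_id s).const_sub t)
    have h2 := ((ContinuousLinearMap.apply ℂ E x).restrictScalars ℝ).hasFDerivAt.comp_hasDerivAt s
      (h1.mul (hasDerivAt_exp_smul_const' (𝕂 := ℝ) F s))
    refine h2.congr_deriv ?_
    simp [neg_add_eq_sub]
  have hb := norm_image_sub_le_of_norm_deriv_le_segment' (a := 0) (b := t)
    (C := M₁ * ‖G - F‖ * M₂ * Real.exp (-μ * t) * ‖x‖)
    (fun s _ => (hd s).hasDerivWithinAt) (fun s hs => ?_) t ⟨ht, le_rfl⟩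
  · simp only [sub_self, zero_smul, sub_zero, NormedSpace.exp_zero,
      one_apply_eq_self] at hb
    have h1 := hF t ht
    have h2 := norm_sub_norm_le (NormedSpace.exp (t • G) x) (NormedSpace.exp (t • F) x)
    rw [norm_sub_rev] at h2
    linarith
  · rw [norm_neg]
    calc _ ≤ M₁ * Real.exp (-μ * (t - s)) * ‖(G - F) (NormedSpace.exp (s • F) x)‖ :=
          hG _ (by linarith [hs.2]) _
      _ ≤ M₁ * Real.exp (-μ * (t - s)) * (‖G - F‖ * (M₂ * Real.exp (-μ * s) * ‖x‖)) := by
          gcongr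
          exact ((G - F).le_opNorm _).trans (by gcongr; exact hF s hs.1)
      _ = M₁ * ‖G - F‖ * M₂ * (Real.exp (-μ * (t - s)) * Real.exp (-μ * s)) * ‖x‖ := by ring
      _ = _ := by rw [← Real.exp_add]; congr 3; ring

/-- The resolvent estimate satisfied by the generator of an exponentially stable semigroup. -/
lemma norm_le_of_exp_decay {E : Type*} [NormedAddCommGroup E] [NormedSpace ℂ E]
    [CompleteSpace E] (F : E →L[ℂ] E) {M α : ℝ} (hM : 0 < M)
    (hF : ∀ t : ℝ, 0 ≤ t → ‖NormedSpace.exp (t • F)‖ ≤ M * Real.exp (-α * t))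
    (lam : ℂ) (hlam : -α < lam.re) (φ : E) :
    ‖φ‖ ≤ M / (lam.re + α) * ‖lam • φ - F φ‖ := by
  set a := lam.re + α with ha
  have ha0 : 0 < a := by linarith
  set N := ‖lam • φ - F φ‖ with hN
  have hexp : ∀ t : ℝ, ‖Complex.exp (-lam * t)‖ = Real.exp (-lam.re * t) := by
    intro t; rw [Complex.norm_exp]; simp
  have hmul : ∀ t : ℝ, 0 ≤ t → ∀ y, ‖Complex.exp (-lam * t) • NormedSpace.exp (t • F) y‖
      ≤ M * Real.exp (-a * t) * ‖y‖ := by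
    intro t ht y
    rw [norm_smul, hexp]
    calc _ ≤ Real.exp (-lam.re * t) * (M * Real.exp (-α * t) * ‖y‖) := by
          gcongr
          exact (ContinuousLinearMap.le_opNorm _ _).trans (by gcongr; exact hF t ht)
      _ = M * (Real.exp (-lam.re * t) * Real.exp (-α * t)) * ‖y‖ := by ring
      _ = _ := by rw [← Real.exp_add]; congr 3; rw [ha]; ring
  have hd : ∀ t : ℝ, HasDerivAt
      (fun t : ℝ => φ - Complex.exp (-lam * t) • NormedSpace.exp (t • F) φ)
      (Complex.exp (-lam * t) • NormedSpace.exp (t • F) (lam • φ - F φ)) t := by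
    intro t
    have h1 : HasDerivAt (fun t : ℝ => Complex.exp (-lam * t))
        (Complex.exp (-lam * t) * (-lam)) t := by
      have := ((Complex.ofRealCLM.hasDerivAt (x := t)).const_mul (-lam)).cexp
      simpa using this
    refine ((h1.smul (hasDerivAt_exp_smul_apply' F φ t)).const_sub φ).congr_deriv ?_
    rw [map_sub, map_smul]
    module
  have hB : ∀ t : ℝ, HasDerivAt (fun t => M * N / a * (1 - Real.exp (-a * t)))
      (M * Real.exp (-a * t) * N) t := by
    intro t
    have h1 : HasDerivAt (fun t : ℝ => Real.exp (-a * t)) (Real.exp (-a * t) * (-a)) t := by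
      simpa using ((hasDerivAt_id t).const_mul (-a)).exp
    refine ((h1.const_sub 1).const_mul (M * N / a)).congr_deriv ?_
    field_simp
  have hbound : ∀ t : ℝ, 0 ≤ t → ‖φ‖ ≤ M / a * N + M * Real.exp (-a * t) * ‖φ‖ := by
    intro t ht
    have h1 := image_norm_le_of_norm_deriv_right_le_deriv_boundary (a := 0) (b := t)
      (fun s _ => (hd s).continuousAt.continuousWithinAt) (fun s _ => (hd s).hasDerivWithinAt)
      (by simp) hB (fun s hs => hmul s hs.1 _) ⟨ht, le_rfl⟩
    have h2 := norm_sub_norm_le φ (Complex.exp (-lam * t) • NormedSpace.exp (t • F) φ)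
    have h3 := hmul t ht φ
    have h4 : M * N / a * (1 - Real.exp (-a * t)) ≤ M * N / a * 1 := by
      gcongr
      linarith [Real.exp_pos (-a * t)]
    have h5 : M * N / a * 1 = M / a * N := by ring
    linarith
  have hlim : Filter.Tendsto (fun t : ℝ => M / a * N + M * Real.exp (-a * t) * ‖φ‖)
      Filter.atTop (nhds (M / a * N + M * 0 * ‖φ‖)) := by
    refine ((Filter.Tendsto.const_mul M ?_).mul_const _).const_add _
    refine Real.tendsto_exp_atBot.comp ?_
    exact Filter.tendsto_id.const_mul_atTop_of_neg (by linarith)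
  have := ge_of_tendsto hlim ((Filter.eventually_ge_atTop 0).mono hbound)
  simpa using this

open ContinuousLinearMap in
/-- An observed system satisfying the Hautus condition at every complex number is exponentially
stabilizable by output injection. -/
lemma exists_output_injection_of_hautus {X U : Type*} [NormedAddCommGroup X]
    [InnerProductSpace ℂ X] [CompleteSpace X] [NormedAddCommGroup U] [InnerProductSpace ℂ U]
    [CompleteSpace U] (C : X →L[ℂ] X) (D : X →L[ℂ] U)
    (h : ∀ μ : ℂ, ∃ c : ℝ, 0 < c ∧ ∀ y : X, c * ‖y‖ ^ 2 ≤ ‖μ • y - C y‖ ^ 2 + ‖D y‖ ^ 2) :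
    ∃ (L : U →L[ℂ] X) (M : ℝ), 0 < M ∧ ∀ t : ℝ, 0 ≤ t → ∀ x,
      ‖NormedSpace.exp (t • (C + L ∘L D)) x‖ ≤ M * Real.exp (-(1 / 2) * t) * ‖x‖ := by
  set s : ℝ := ‖C‖ + 2 with hs
  have hs2 : 2 ≤ s := by linarith [norm_nonneg C]
  set Z : X →L[ℂ] X := (s : ℂ) • 1 + C with hZ
  have hZapp : ∀ x, Z x = (s : ℂ) • x + C x := fun x => by simp [hZ]
  have hZunit : IsUnit Z := by
    refine isUnit_of_forall_le_norm_inner_map (𝕜 := ℂ) _ (c := 1) one_pos fun x => ?_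
    have h1 : ‖inner ℂ (C x) x‖ ≤ ‖C‖ * ‖x‖ ^ 2 :=
      calc _ ≤ ‖C x‖ * ‖x‖ := norm_inner_le_norm _ _
        _ ≤ ‖C‖ * ‖x‖ * ‖x‖ := by gcongr; exact C.le_opNorm x
        _ = _ := by ring
    have h2 : ‖inner ℂ ((s : ℂ) • x) x‖ = s * ‖x‖ ^ 2 := by
      rw [inner_smul_left, inner_self_eq_norm_sq_to_K, norm_mul, RCLike.norm_conj,
        Complex.norm_real, Real.norm_of_nonneg (by linarith)]
      simp
    have h3 := norm_sub_norm_le (inner ℂ ((s : ℂ) • x) x) (-inner ℂ (C x) x)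
    rw [sub_neg_eq_add, ← inner_add_left, norm_neg, ← hZapp] at h3
    rw [NNReal.coe_one]
    nlinarith [sq_nonneg ‖x‖]
  obtain ⟨u, hu⟩ := hZunit
  set R : X →L[ℂ] X := ↑u⁻¹ with hR
  have hRZ : ∀ x, R (Z x) = x := fun x => by
    rw [← hu]; exact congrArg (fun S : X →L[ℂ] X => S x) u.inv_mul
  have hZR : ∀ x, Z (R x) = x := fun x => by
    rw [← hu]; exact congrArg (fun S : X →L[ℂ] X => S x) u.mul_inv
  have hZle : ∀ x, ‖Z x‖ ≤ ‖Z‖ * ‖x‖ := Z.le_opNorm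
  have hautusR : ∀ μ : ℂ, ∃ c : ℝ, 0 < c ∧
      ∀ y : X, c * ‖y‖ ^ 2 ≤ ‖μ • y - R y‖ ^ 2 + ‖D y‖ ^ 2 := by
    have key : ∀ (μ : ℂ) (c b : ℝ), 0 < c →
        (∀ y, c * ‖y‖ ^ 2 ≤ b ^ 2 * ‖μ • y - R y‖ ^ 2 + ‖D y‖ ^ 2) → ∃ c : ℝ, 0 < c ∧
        ∀ y : X, c * ‖y‖ ^ 2 ≤ ‖μ • y - R y‖ ^ 2 + ‖D y‖ ^ 2 := by
      intro μ c b hc hb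
      refine ⟨c / (b ^ 2 + 1), by positivity, fun y => ?_⟩
      rw [div_mul_eq_mul_div, div_le_iff₀ (by positivity)]
      nlinarith [hb y, sq_nonneg ‖μ • y - R y‖, mul_nonneg (sq_nonneg b) (sq_nonneg ‖D y‖)]
    intro μ
    rcases eq_or_ne μ 0 with rfl | hμ
    · refine key 0 1 ‖Z‖ one_pos fun y => ?_
      have h1 := hZle (R y)
      rw [hZR] at h1
      rw [zero_smul, zero_sub, norm_neg, ← mul_pow, one_mul]
      have := pow_le_pow_left₀ (norm_nonneg _) h1 2
      nlinarith [sq_nonneg ‖D y‖]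
    · obtain ⟨c, hc, hcy⟩ := h (μ⁻¹ - s)
      refine key μ c (‖μ⁻¹‖ * ‖Z‖) hc fun y => (hcy y).trans ?_
      rw [← mul_pow]
      gcongr
      have h1 : (μ⁻¹ - s) • y - C y = -(μ⁻¹ • Z (μ • y - R y)) := by
        rw [map_sub, map_smul, hZR, hZapp, smul_sub, smul_smul, inv_mul_cancel₀ hμ]
        module
      rw [h1, norm_neg, norm_smul, mul_assoc]
      gcongr
      exact hZle _
  obtain ⟨n, c, hc, hkal⟩ := exists_kalman_of_hautus R D hautusR
  set E : ℕ → X →L[ℂ] U := fun k => D ∘L R ^ (k + 1) with hE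
  set W : X →L[ℂ] X := ∑ k ∈ Finset.range n, adjoint (E k) ∘L E k with hW
  have hWinner : ∀ x y, inner ℂ (W x) y = ∑ k ∈ Finset.range n, inner ℂ (E k x) (E k y) := by
    intro x y
    simp [hW, sum_apply, adjoint_inner_left]
  have hWinner' : ∀ x y, inner ℂ x (W y) = ∑ k ∈ Finset.range n, inner ℂ (E k x) (E k y) := by
    intro x y
    simp [hW, sum_apply, adjoint_inner_right]
  have hWsymm : ∀ x y, inner ℂ (W x) y = inner ℂ x (W y) := fun x y => by
    rw [hWinner, hWinner']
  have hV : ∀ x, (inner ℂ (W x) x).re = ∑ k ∈ Finset.range n, ‖E k x‖ ^ 2 := by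
    intro x
    rw [hWinner, Complex.re_sum]
    exact Finset.sum_congr rfl fun k _ => inner_self_eq_norm_sq (𝕜 := ℂ) _
  have hEZ : ∀ k x, E k (Z x) = D ((R ^ k) x) := by
    intro k x
    simp [hE, pow_succ, hRZ]
  have hVZ : ∀ x, ∑ k ∈ Finset.range n, ‖E k (Z x)‖ ^ 2
      ≤ ‖D x‖ ^ 2 + ∑ k ∈ Finset.range n, ‖E k x‖ ^ 2 := by
    intro x
    have h1 := Finset.sum_range_succ' (fun k => ‖D ((R ^ k) x)‖ ^ 2) n
    rw [Finset.sum_range_succ] at h1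
    have h2 : ∀ k, ‖E k x‖ = ‖D ((R ^ (k + 1)) x)‖ := fun k => rfl
    simp only [hEZ, h2]
    simp only [pow_zero, one_apply_eq_self] at h1
    linarith [sq_nonneg ‖D ((R ^ n) x)‖]
  have hVexp : ∀ x, ∑ k ∈ Finset.range n, ‖E k (Z x)‖ ^ 2
      = ∑ k ∈ Finset.range n, ‖E k (C x)‖ ^ 2 + 2 * s * (inner ℂ (W x) (C x)).re
        + s ^ 2 * ∑ k ∈ Finset.range n, ‖E k x‖ ^ 2 := by
    intro x
    rw [hWinner, Complex.re_sum, Finset.mul_sum, Finset.mul_sum, ← Finset.sum_add_distrib,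
      ← Finset.sum_add_distrib]
    refine Finset.sum_congr rfl fun k _ => ?_
    rw [hZapp, map_add, map_smul, norm_add_sq (𝕜 := ℂ), norm_smul, Complex.norm_real,
      Real.norm_of_nonneg (by linarith), inner_smul_left, Complex.conj_ofReal, RCLike.re_to_complex,
      Complex.re_ofReal_mul]
    ring
  have hcoer : ∀ x, c / (‖Z‖ ^ 2 + 1) * ‖x‖ ^ 2 ≤ (inner ℂ (W x) x).re := by
    intro x
    have h1 := hkal (R x)
    have h2 : ∀ k, D ((R ^ k) (R x)) = E k x := fun k => by simp [hE, pow_succ]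
    simp only [h2] at h1
    have h3 := hZle (R x)
    rw [hZR] at h3
    have h4 := pow_le_pow_left₀ (norm_nonneg _) h3 2
    rw [hV, div_mul_eq_mul_div, div_le_iff₀ (by positivity)]
    rw [mul_pow] at h4
    nlinarith [mul_le_mul_of_nonneg_left h4 hc.le, mul_le_mul_of_nonneg_left h1 (sq_nonneg ‖Z‖),
      mul_nonneg hc.le (sq_nonneg ‖R x‖)]
  have hc' : 0 < c / (‖Z‖ ^ 2 + 1) := by positivity
  have hWunit : IsUnit W := by
    refine isUnit_of_forall_le_norm_inner_map (𝕜 := ℂ) _ (c := ⟨_, hc'.le⟩) hc' fun x => ?_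
    rw [mul_comm]
    exact (hcoer x).trans (Complex.re_le_norm _)
  obtain ⟨w, hw⟩ := hWunit
  have hWw : ∀ x, W ((↑w⁻¹ : X →L[ℂ] X) x) = x := fun x => by
    rw [← hw]; exact congrArg (fun S : X →L[ℂ] X => S x) w.mul_inv
  refine ⟨-((↑w⁻¹ : X →L[ℂ] X) ∘L adjoint D),
    norm_exp_smul_apply_le_of_lyapunov _ W hWsymm hc' hcoer fun x => ?_⟩
  have h1 : (inner ℂ (W x) ((-((↑w⁻¹ : X →L[ℂ] X) ∘L adjoint D)) (D x))).re = -‖D x‖ ^ 2 := by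
    rw [hWsymm, neg_apply, map_neg, comp_apply, hWw, inner_neg_right, adjoint_inner_right,
      Complex.neg_re]
    exact congrArg Neg.neg (inner_self_eq_norm_sq (𝕜 := ℂ) _)
  rw [add_apply, comp_apply, inner_add_right, Complex.add_re, h1]
  have h2 := hVZ x
  rw [hVexp, ← hV x] at h2
  have h3 : 0 ≤ ∑ k ∈ Finset.range n, ‖E k (C x)‖ ^ 2 := by positivity
  have h4 : 0 ≤ (inner ℂ (W x) x).re := by rw [hV]; positivity
  set v := (inner ℂ (W x) x).re
  set p := (inner ℂ (W x) (C x)).re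
  have h5 : s * (2 * (p + -‖D x‖ ^ 2) + v) ≤ 0 := by
    nlinarith [sq_nonneg ‖D x‖, mul_nonneg (by nlinarith : 0 ≤ s ^ 2 - s - 1) h4,
      mul_nonneg (by linarith : 0 ≤ s - 2) (sq_nonneg ‖D x‖)]
  linarith [nonpos_of_mul_nonpos_right h5 (by linarith)]

open ContinuousLinearMap in
/-- Under the decomposition assumption (b): for every `α > 0` the space `H` splits into
closed invariant subspaces `Q₁ ⊕ Q₂` where the restriction of `A*` to `Q₁` is a bounded
operator with spectrum in `{Re z > -α}` and the semigroup restricted to `Q₂` is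
exponentially stable, the system `[A,B]` is exponentially stabilizable iff
`(A*, B*)` satisfies (HESI)_β for some `β > 0`. -/
theorem stabilizable_iff_HESI_of_decomposition
    {H U : Type*}
    [NormedAddCommGroup H] [InnerProductSpace ℂ H] [CompleteSpace H]
    [TopologicalSpace.SeparableSpace H]
    [NormedAddCommGroup U] [InnerProductSpace ℂ U] [CompleteSpace U]
    [TopologicalSpace.SeparableSpace U]
    (A : H →L[ℂ] H) (B : U →L[ℂ] H)
    (hdec : ∀ α : ℝ, 0 < α → ∃ Q₁ Q₂ : Submodule ℂ H,
      IsClosed (Q₁ : Set H) ∧ IsClosed (Q₂ : Set H) ∧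
      -- (b₁) unique decomposition H = Q₁ ⊕ Q₂
      (∀ x : H, ∃! p : Q₁ × Q₂, x = (p.1 : H) + (p.2 : H)) ∧
      -- (b₂) invariance of Q₁ and Q₂ under the semigroup generated by A*
      (∀ t : ℝ, 0 ≤ t → ∀ x ∈ Q₁,
        NormedSpace.exp (t • ContinuousLinearMap.adjoint A) x ∈ Q₁) ∧
      (∀ t : ℝ, 0 ≤ t → ∀ x ∈ Q₂,
        NormedSpace.exp (t • ContinuousLinearMap.adjoint A) x ∈ Q₂) ∧
      -- (b₃) the restriction of A* to Q₁ has spectrum in {Re z > -α}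
      (∃ T₁ : Q₁ →L[ℂ] Q₁,
        (∀ x : Q₁, (T₁ x : H) = ContinuousLinearMap.adjoint A (x : H)) ∧
        ∀ z ∈ spectrum ℂ T₁, -α < z.re) ∧
      -- (b₄) the semigroup restricted to Q₂ is exponentially stable
      (∃ M : ℝ, 0 < M ∧ ∃ δ : ℝ, 0 < δ ∧ ∀ x ∈ Q₂, ∀ t : ℝ, 0 ≤ t →
        ‖NormedSpace.exp (t • ContinuousLinearMap.adjoint A) x‖
          ≤ M * Real.exp (-δ * t) * ‖x‖)) :
    (∃ K : H →L[ℂ] U, ∃ M : ℝ, 0 < M ∧ ∃ α : ℝ, 0 < α ∧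
      ∀ t : ℝ, 0 ≤ t →
        ‖NormedSpace.exp (t • (A + B ∘L K))‖ ≤ M * Real.exp (-α * t)) ↔
    (∃ β : ℝ, 0 < β ∧ ∃ C : ℝ, 0 < C ∧ ∀ lam : ℂ, -β < lam.re → ∀ φ : H,
      ‖φ‖ ^ 2 ≤ C / (lam.re + β) ^ 2 *
        (‖lam • φ - (ContinuousLinearMap.adjoint A) φ‖ ^ 2
          + ‖(ContinuousLinearMap.adjoint B) φ‖ ^ 2)) := by
  constructor
  · rintro ⟨K, M, hM, α, hα, hexp⟩
    set F : H →L[ℂ] H := adjoint (A + B ∘L K) with hF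
    have hFapp : ∀ φ, F φ = adjoint A φ + adjoint K (adjoint B φ) := fun φ => by
      simp [hF, adjoint_comp]
    have hFexp : ∀ t : ℝ, 0 ≤ t → ‖NormedSpace.exp (t • F)‖ ≤ M * Real.exp (-α * t) := by
      intro t ht
      have h1 : t • F = star (t • (A + B ∘L K)) := by
        rw [star_smul, star_trivial, hF, star_eq_adjoint]
      rw [h1, ← NormedSpace.star_exp, norm_star]
      exact hexp t ht
    refine ⟨α, hα, 2 * M ^ 2 * (1 + ‖adjoint K‖ ^ 2), by positivity, fun lam hlam φ => ?_⟩
    have h1 := norm_le_of_exp_decay F hM hFexp lam hlam φ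
    have ha : 0 < lam.re + α := by linarith
    set p := ‖lam • φ - adjoint A φ‖
    set q := ‖adjoint B φ‖
    have h2 : ‖lam • φ - F φ‖ ≤ p + ‖adjoint K‖ * q := by
      rw [hFapp, ← sub_sub]
      exact (norm_sub_le _ _).trans (by gcongr; exact le_opNorm _ _)
    have h3 : (p + ‖adjoint K‖ * q) ^ 2 ≤ 2 * (1 + ‖adjoint K‖ ^ 2) * (p ^ 2 + q ^ 2) := by
      nlinarith [sq_nonneg (p - ‖adjoint K‖ * q), sq_nonneg q, sq_nonneg (‖adjoint K‖ * p)]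
    calc ‖φ‖ ^ 2 ≤ (M / (lam.re + α) * (p + ‖adjoint K‖ * q)) ^ 2 :=
          pow_le_pow_left₀ (norm_nonneg _) (h1.trans (by gcongr)) 2
      _ = M ^ 2 / (lam.re + α) ^ 2 * (p + ‖adjoint K‖ * q) ^ 2 := by rw [mul_pow, div_pow]
      _ ≤ M ^ 2 / (lam.re + α) ^ 2 * (2 * (1 + ‖adjoint K‖ ^ 2) * (p ^ 2 + q ^ 2)) := by gcongr
      _ = _ := by ring
  · rintro ⟨β, hβ, C, hC, hHESI⟩
    obtain ⟨Q₁, Q₂, hQ₁, hQ₂, hsum, -, -, ⟨T, hT, hspec⟩, M₂, hM₂, δ, hδ, hstab⟩ := hdec β hβ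
    have := hQ₁.completeSpace_coe
    have := hQ₂.completeSpace_coe
    have hautus : ∀ μ : ℂ, ∃ c : ℝ, 0 < c ∧ ∀ y : Q₁, c * ‖y‖ ^ 2
        ≤ ‖μ • y - T y‖ ^ 2 + ‖(adjoint B ∘L Q₁.subtypeL) y‖ ^ 2 := by
      intro μ
      rcases lt_or_ge (-β) μ.re with hμ | hμ
      · have ha : 0 < μ.re + β := by linarith
        refine ⟨(μ.re + β) ^ 2 / C, by positivity, fun y => ?_⟩
        have h1 := hHESI μ hμ y
        rw [div_mul_eq_mul_div, le_div_iff₀ (by positivity)] at h1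
        rw [div_mul_eq_mul_div, div_le_iff₀ hC]
        have h2 : ‖μ • y - T y‖ = ‖μ • (y : H) - adjoint A y‖ := by
          rw [← hT]; rfl
        rw [h2]
        simp only [comp_apply, Submodule.subtypeL_apply, Submodule.coe_norm]
        linarith
      · have hres : μ ∈ resolventSet ℂ T := by
          by_contra hnot
          exact absurd (hspec μ hnot) (not_lt.2 hμ)
        obtain ⟨u, hu⟩ : IsUnit (algebraMap ℂ (Q₁ →L[ℂ] Q₁) μ - T) := hres
        set J : Q₁ →L[ℂ] Q₁ := ↑u⁻¹
        refine ⟨1 / (‖J‖ ^ 2 + 1), by positivity, fun y => ?_⟩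
        have h1 : J (μ • y - T y) = y := by
          have h2 : (u : Q₁ →L[ℂ] Q₁) y = μ • y - T y := by
            rw [hu]; simp [Algebra.algebraMap_eq_smul_one]
          rw [← h2]
          exact congrArg (fun S : Q₁ →L[ℂ] Q₁ => S y) u.inv_mul
        have h3 := J.le_opNorm (μ • y - T y)
        rw [h1] at h3
        have h4 := pow_le_pow_left₀ (norm_nonneg _) h3 2
        rw [mul_pow] at h4
        rw [div_mul_eq_mul_div, div_le_iff₀ (by positivity), one_mul]
        nlinarith [sq_nonneg ‖μ • y - T y‖, sq_nonneg ‖(adjoint B ∘L Q₁.subtypeL) y‖,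
          mul_nonneg (sq_nonneg ‖J‖) (sq_nonneg ‖(adjoint B ∘L Q₁.subtypeL) y‖)]
    obtain ⟨L, M₁, hM₁, hdecay⟩ := exists_output_injection_of_hautus T _ hautus
    set S : H →L[ℂ] H := (Q₁.subtypeL ∘L L) ∘L adjoint B with hS
    set G : H →L[ℂ] H := adjoint A + S with hG
    have hGadj : adjoint G = A + B ∘L adjoint (Q₁.subtypeL ∘L L) := by
      rw [hG, hS, map_add, adjoint_comp, adjoint_adjoint, adjoint_adjoint]
    have hGS : G - adjoint A = S := by rw [hG, add_sub_cancel_left]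
    set μ := min (1 / 2) δ with hμ
    have hμ0 : 0 < μ := lt_min (by norm_num) hδ
    have hμ1 : μ ≤ 1 / 2 := min_le_left _ _
    have hμ2 : μ ≤ δ := min_le_right _ _
    have hG₁ : ∀ t : ℝ, 0 ≤ t → ∀ y : Q₁,
        ‖NormedSpace.exp (t • G) (y : H)‖ ≤ M₁ * Real.exp (-μ * t) * ‖(y : H)‖ := by
      intro t ht y
      have h1 := exp_smul_apply_of_intertwine Q₁.subtypeL
        (T + L ∘L (adjoint B ∘L Q₁.subtypeL)) G (fun x => by simp [hG, hS, hT]) t y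
      rw [Submodule.subtypeL_apply] at h1
      rw [h1, Submodule.subtypeL_apply, ← Submodule.coe_norm, ← Submodule.coe_norm]
      refine (hdecay t ht y).trans ?_
      gcongr
    have hG₂ : ∀ t : ℝ, 0 ≤ t → ∀ y ∈ Q₂, ‖NormedSpace.exp (t • G) y‖
        ≤ M₂ * (1 + M₁ * ‖S‖ * t) * Real.exp (-μ * t) * ‖y‖ := by
      intro t ht y hy
      rw [← hGS]
      refine norm_exp_smul_apply_le_of_perturbation (adjoint A) G hM₁.le (fun t ht y => ?_) y
        (fun t ht => (hstab y hy t ht).trans (by gcongr)) ht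
      rw [hGS]
      exact hG₁ t ht (L (adjoint B y))
    obtain ⟨C₀, hC₀, hpre⟩ := exists_preimage_norm_le (Q₁.subtypeL.coprod Q₂.subtypeL) (by
      intro x
      obtain ⟨p, hp, -⟩ := hsum x
      exact ⟨p, by simp [hp]⟩)
    set a := M₁ * ‖S‖ with ha
    have ha0 : 0 ≤ a := by positivity
    refine ⟨adjoint (Q₁.subtypeL ∘L L), (M₁ + M₂ * (1 + a * (2 / μ))) * C₀, by positivity,
      μ / 2, by positivity, fun t ht => ?_⟩
    have hstar : t • (A + B ∘L adjoint (Q₁.subtypeL ∘L L)) = star (t • G) := by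
      rw [star_smul, star_trivial, star_eq_adjoint, hGadj]
    rw [hstar, ← NormedSpace.star_exp, norm_star]
    refine opNorm_le_bound _ (by positivity) fun x => ?_
    obtain ⟨⟨x₁, x₂⟩, hx, hxn⟩ := hpre x
    have hx₁ : ‖(x₁ : H)‖ ≤ C₀ * ‖x‖ := (norm_fst_le (x₁, x₂)).trans hxn
    have hx₂ : ‖(x₂ : H)‖ ≤ C₀ * ‖x‖ := (norm_snd_le (x₁, x₂)).trans hxn
    have hsplit : x = (x₁ : H) + (x₂ : H) := by rw [← hx]; simp
    set e := Real.exp (-(μ / 2) * t) with he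
    have he0 : 0 < e := Real.exp_pos _
    have hee : Real.exp (-μ * t) = e * e := by
      rw [he, ← Real.exp_add]; congr 1; ring
    have he1 : e ≤ 1 := Real.exp_le_one_iff.2 (by nlinarith)
    have hte : t * e ≤ 2 / μ := by
      have h1 := Real.add_one_le_exp (μ / 2 * t)
      have h2 : Real.exp (μ / 2 * t) * e = 1 := by
        rw [he, ← Real.exp_add]; simp
      rw [le_div_iff₀ hμ0]
      nlinarith
    calc ‖NormedSpace.exp (t • G) x‖
        ≤ ‖NormedSpace.exp (t • G) (x₁ : H)‖ + ‖NormedSpace.exp (t • G) (x₂ : H)‖ := by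
          nth_rewrite 1 [hsplit]
          rw [map_add]
          exact norm_add_le _ _
      _ ≤ M₁ * (e * e) * (C₀ * ‖x‖) + M₂ * (1 + a * t) * (e * e) * (C₀ * ‖x‖) := by
          rw [← hee]
          refine add_le_add ((hG₁ t ht x₁).trans (by gcongr))
            ((hG₂ t ht x₂ x₂.2).trans ?_)
          gcongr
      _ = (M₁ * e + M₂ * (e + a * (t * e))) * e * (C₀ * ‖x‖) := by ring
      _ ≤ (M₁ * 1 + M₂ * (1 + a * (2 / μ))) * e * (C₀ * ‖x‖) := by gcongr
      _ = (M₁ + M₂ * (1 + a * (2 / μ))) * C₀ * e * ‖x‖ := by ring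
end

section
/- Let H and U be separable complex Hilbert spaces, A : H → H and B : U → H bounded linear operators. If the system [A,B] is exponentially stabilizable, then the pair (A*,B*) satisfies (HESI)_β for some β > 0. -/
open ContinuousLinearMap in
/-- If the semigroup generated by `T` decays like `M * exp (-α * t)`, then `lam - T` is bounded
below by `(re lam + α) / M` for every `lam` with `-α < re lam`. -/
theorem norm_le_div_mul_norm_smul_sub_of_norm_exp_le
    {E : Type*} [NormedAddCommGroup E] [NormedSpace ℂ E] [CompleteSpace E]
    (T : E →L[ℂ] E) {M α : ℝ}
    (hT : ∀ t : ℝ, 0 ≤ t → ‖NormedSpace.exp (t • T)‖ ≤ M * Real.exp (-α * t))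
    {lam : ℂ} (hlam : -α < lam.re) (x : E) :
    ‖x‖ ≤ M / (lam.re + α) * ‖lam • x - T x‖ := by
  set c := lam.re + α with hc
  have hc0 : 0 < c := by linarith
  set g := lam • x - T x with hg
  let F : ℝ → E := fun t => Complex.exp (-lam * t) • NormedSpace.exp (t • T) x
  have bound (t : ℝ) (ht : 0 ≤ t) (y : E) :
      ‖Complex.exp (-lam * t) • NormedSpace.exp (t • T) y‖ ≤ M * ‖y‖ * Real.exp (-c * t) := by
    have h1 : ‖Complex.exp (-lam * t)‖ = Real.exp (-lam.re * t) := by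
      rw [Complex.norm_exp]; simp
    rw [norm_smul, h1]
    calc Real.exp (-lam.re * t) * ‖NormedSpace.exp (t • T) y‖
        ≤ Real.exp (-lam.re * t) * (M * Real.exp (-α * t) * ‖y‖) := by
          gcongr
          exact le_of_opNorm_le _ (hT t ht) y
      _ = M * ‖y‖ * (Real.exp (-lam.re * t) * Real.exp (-α * t)) := by ring
      _ = M * ‖y‖ * Real.exp (-c * t) := by
          rw [← Real.exp_add, hc]; ring_nf
  have hF (t : ℝ) :
      HasDerivAt F (-(Complex.exp (-lam * t) • NormedSpace.exp (t • T) g)) t := by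
    have h1 : HasDerivAt (fun t : ℝ => Complex.exp (-lam * t))
        (Complex.exp (-lam * t) * (-lam)) t := by
      simpa using ((Complex.ofRealCLM.hasDerivAt (x := t)).const_mul (-lam)).cexp
    have h2 : HasDerivAt (fun t : ℝ => NormedSpace.exp (t • T) x)
        (NormedSpace.exp (t • T) (T x)) t :=
      (((ContinuousLinearMap.apply ℂ E x).restrictScalars ℝ).hasFDerivAt.comp_hasDerivAt t
        (hasDerivAt_exp_smul_const (𝕂 := ℝ) T t))
    have h3 : -(Complex.exp (-lam * t) • NormedSpace.exp (t • T) g)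
        = Complex.exp (-lam * t) • NormedSpace.exp (t • T) (T x)
          + (Complex.exp (-lam * t) * (-lam)) • NormedSpace.exp (t • T) x := by
      rw [hg, map_sub, map_smul]
      module
    rw [h3]
    exact h1.smul h2
  have hF0 : F 0 = x := by simp [F]
  have hcexp (t : ℝ) : HasDerivAt (fun t : ℝ => M * ‖g‖ * ((1 - Real.exp (-c * t)) / c))
      (M * ‖g‖ * Real.exp (-c * t)) t := by
    have h := (((((hasDerivAt_id t).const_mul (-c)).exp.const_sub 1).div_const c).const_mul
      (M * ‖g‖))
    refine h.congr_deriv ?_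
    simp only [id_eq]
    field_simp
  have key (t : ℝ) (ht : 0 ≤ t) : ‖F t - x‖ ≤ M * ‖g‖ * ((1 - Real.exp (-c * t)) / c) := by
    refine image_norm_le_of_norm_deriv_right_le_deriv_boundary (a := 0) (b := t)
      (f := fun t => F t - x)
      (fun s _ => ((hF s).sub_const x).continuousAt.continuousWithinAt)
      (fun s _ => ((hF s).sub_const x).hasDerivWithinAt) (by simp [hF0]) hcexp ?_ ⟨ht, le_rfl⟩
    intro s hs
    rw [norm_neg]
    exact bound s hs.1 g
  have hexp : Filter.Tendsto (fun t : ℝ => Real.exp (-c * t)) Filter.atTop (nhds 0) :=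
    Real.tendsto_exp_atBot.comp (Filter.tendsto_id.const_mul_atTop_of_neg (by linarith))
  have hlim : Filter.Tendsto (fun t : ℝ => M * ‖x‖ * Real.exp (-c * t)
      + M * ‖g‖ * ((1 - Real.exp (-c * t)) / c)) Filter.atTop
      (nhds (M * ‖x‖ * 0 + M * ‖g‖ * ((1 - 0) / c))) :=
    (hexp.const_mul _).add (((hexp.const_sub 1).div_const c).const_mul _)
  have hfin := ge_of_tendsto hlim (b := ‖x‖) <| by
    filter_upwards [Filter.eventually_ge_atTop 0] with t ht
    calc ‖x‖ = ‖F t - (F t - x)‖ := by simp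
      _ ≤ ‖F t‖ + ‖F t - x‖ := norm_sub_le _ _
      _ ≤ _ := add_le_add (bound t ht x) (key t ht)
  calc ‖x‖ ≤ M * ‖x‖ * 0 + M * ‖g‖ * ((1 - 0) / c) := hfin
    _ = M / c * ‖g‖ := by ring

/-- Necessity of the frequency-domain condition: if the system `[A,B]` is exponentially
stabilizable, then the pair `(A*, B*)` satisfies (HESI)_β for some `β > 0`. -/
theorem HESI_of_stabilizable
    {H U : Type*}
    [NormedAddCommGroup H] [InnerProductSpace ℂ H] [CompleteSpace H]
    [TopologicalSpace.SeparableSpace H]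
    [NormedAddCommGroup U] [InnerProductSpace ℂ U] [CompleteSpace U]
    [TopologicalSpace.SeparableSpace U]
    (A : H →L[ℂ] H) (B : U →L[ℂ] H)
    (hstab : ∃ K : H →L[ℂ] U, ∃ M : ℝ, 0 < M ∧ ∃ α : ℝ, 0 < α ∧
      ∀ t : ℝ, 0 ≤ t →
        ‖NormedSpace.exp (t • (A + B ∘L K))‖ ≤ M * Real.exp (-α * t)) :
    ∃ β : ℝ, 0 < β ∧ ∃ C : ℝ, 0 < C ∧ ∀ lam : ℂ, -β < lam.re → ∀ φ : H,
      ‖φ‖ ^ 2 ≤ C / (lam.re + β) ^ 2 *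
        (‖lam • φ - (ContinuousLinearMap.adjoint A) φ‖ ^ 2
          + ‖(ContinuousLinearMap.adjoint B) φ‖ ^ 2) := by
  obtain ⟨K, M, hM, α, hα, hK⟩ := hstab
  refine ⟨α, hα, M ^ 2 * (1 + ‖K‖ ^ 2), by positivity, fun lam hlam φ => ?_⟩
  have hT (t : ℝ) (ht : 0 ≤ t) :
      ‖NormedSpace.exp (t • (A + B ∘L K).adjoint)‖ ≤ M * Real.exp (-α * t) := by
    have h : NormedSpace.exp (t • (A + B ∘L K).adjoint)
        = star (NormedSpace.exp (t • (A + B ∘L K))) := by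
      rw [← ContinuousLinearMap.star_eq_adjoint, NormedSpace.star_exp, star_smul, star_trivial t]
    rw [h, norm_star]
    exact hK t ht
  have hmain := norm_le_div_mul_norm_smul_sub_of_norm_exp_le _ hT hlam φ
  have hc : 0 < lam.re + α := by linarith
  set a := ‖lam • φ - A.adjoint φ‖
  set b := ‖B.adjoint φ‖
  have hg : ‖lam • φ - (A + B ∘L K).adjoint φ‖ ≤ a + ‖K‖ * b := by
    have h : lam • φ - (A + B ∘L K).adjoint φ
        = (lam • φ - A.adjoint φ) - K.adjoint (B.adjoint φ) := by
      rw [map_add, ContinuousLinearMap.adjoint_comp]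
      simp [sub_sub]
    rw [h]
    refine (norm_sub_le _ _).trans (add_le_add_right ?_ _)
    simpa using K.adjoint.le_opNorm (B.adjoint φ)
  have hφ : ‖φ‖ ≤ M / (lam.re + α) * (a + ‖K‖ * b) := hmain.trans (by gcongr)
  calc ‖φ‖ ^ 2 ≤ (M / (lam.re + α) * (a + ‖K‖ * b)) ^ 2 := by gcongr
    _ = (M / (lam.re + α)) ^ 2 * (a + ‖K‖ * b) ^ 2 := by ring
    _ ≤ (M / (lam.re + α)) ^ 2 * ((1 + ‖K‖ ^ 2) * (a ^ 2 + b ^ 2)) := by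
        gcongr
        nlinarith [sq_nonneg (b - ‖K‖ * a)]
    _ = M ^ 2 * (1 + ‖K‖ ^ 2) / (lam.re + α) ^ 2 * (a ^ 2 + b ^ 2) := by
        rw [div_pow]; ring
end

section
/- Let H and U be separable complex Hilbert spaces, A : H → H and B : U → H bounded linear operators. If the system [A,B] is rapidly stabilizable, then the pair (A*,B*) satisfies (HESI)_β for every β > 0. -/
/-- If the semigroup `exp (t S)` decays at rate `β`, then the resolvent of `S` is bounded by
`M / (re z + β)` on the half-plane `re z > -β`. -/
theorem norm_le_of_norm_exp_smul_le {E : Type*} [NormedAddCommGroup E] [NormedSpace ℂ E]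
    [CompleteSpace E] (S : E →L[ℂ] E) {M β : ℝ}
    (hS : ∀ t : ℝ, 0 ≤ t → ‖NormedSpace.exp (t • S)‖ ≤ M * Real.exp (-β * t))
    {z : ℂ} (hz : -β < z.re) (x : E) :
    (z.re + β) * ‖x‖ ≤ M * ‖z • x - S x‖ := by
  set μ : ℝ := z.re + β with hμ
  have hμ0 : 0 < μ := by linarith
  set y : E := z • x - S x with hy
  set g : ℝ → E := fun t => Complex.exp (-z * t) • (NormedSpace.exp (t • S)) x with hg
  have hnorm (w : E) (t : ℝ) (ht : 0 ≤ t) :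
      ‖Complex.exp (-z * t) • (NormedSpace.exp (t • S)) w‖ ≤
        M * Real.exp (-μ * t) * ‖w‖ := by
    rw [norm_smul, Complex.norm_exp]
    have hre : (-z * (t : ℂ)).re = -z.re * t := by simp
    have hexp : Real.exp (-μ * t) = Real.exp (-z.re * t) * Real.exp (-β * t) := by
      rw [← Real.exp_add]; congr 1; rw [hμ]; ring
    rw [hre, hexp]
    calc Real.exp (-z.re * t) * ‖(NormedSpace.exp (t • S)) w‖
        ≤ Real.exp (-z.re * t) * (M * Real.exp (-β * t) * ‖w‖) := by
          gcongr
          exact ContinuousLinearMap.le_of_opNorm_le _ (hS t ht) w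
      _ = _ := by ring
  have hderiv (t : ℝ) : HasDerivAt g
      (-(Complex.exp (-z * t) • (NormedSpace.exp (t • S)) y)) t := by
    have h1 : HasDerivAt (fun t : ℝ => Complex.exp (-z * t)) (Complex.exp (-z * t) * -z) t := by
      have := ((Complex.ofRealCLM.hasDerivAt (x := t)).const_mul (-z)).cexp
      simpa using this
    have h2 : HasDerivAt (fun t : ℝ => (NormedSpace.exp (t • S)) x)
        ((NormedSpace.exp (t • S)) (S x)) t := by
      have h := hasDerivAt_exp_smul_const (𝕂 := ℝ) S t
      exact ((ContinuousLinearMap.apply ℂ E x).restrictScalars ℝ).hasFDerivAt.comp_hasDerivAt t h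
    refine (h1.smul h2).congr_deriv ?_
    rw [hy, map_sub, map_smul]
    module
  have hbound (t : ℝ) (ht : 0 ≤ t) :
      ‖g t - x‖ ≤ M * ‖y‖ / μ * (1 - Real.exp (-μ * t)) := by
    have hB (s : ℝ) : HasDerivAt (fun s => M * ‖y‖ / μ * (1 - Real.exp (-μ * s)))
        (M * Real.exp (-μ * s) * ‖y‖) s := by
      have := ((((hasDerivAt_id s).const_mul (-μ)).exp).const_sub 1).const_mul (M * ‖y‖ / μ)
      refine this.congr_deriv ?_
      simp only [id]
      field_simp
    refine image_norm_le_of_norm_deriv_right_le_deriv_boundary (a := 0) (b := t)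
      (f := fun s => g s - x)
      (f' := fun s => -(Complex.exp (-z * s) • (NormedSpace.exp (s • S)) y))
      (fun s _ => ((hderiv s).sub_const x).continuousAt.continuousWithinAt)
      (fun s _ => ((hderiv s).sub_const x).hasDerivWithinAt)
      ?_ (fun s => hB s) ?_ ⟨ht, le_rfl⟩
    · simp [hg]
    · intro s hs
      rw [norm_neg]
      exact hnorm y s hs.1
  have hx (t : ℝ) (ht : 0 ≤ t) :
      ‖x‖ ≤ M * Real.exp (-μ * t) * ‖x‖ + M * ‖y‖ / μ * (1 - Real.exp (-μ * t)) := by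
    have h1 := norm_sub_norm_le x (g t)
    rw [norm_sub_rev] at h1
    linarith [hbound t ht, hnorm x t ht]
  have hlim : Filter.Tendsto (fun t : ℝ => Real.exp (-μ * t)) Filter.atTop (nhds 0) :=
    Real.tendsto_exp_atBot.comp
      (Filter.tendsto_id.const_mul_atTop_of_neg (neg_lt_zero.mpr hμ0))
  have hlim' := ((hlim.const_mul M).mul_const ‖x‖).add
    ((hlim.const_sub 1).const_mul (M * ‖y‖ / μ))
  have hle := ge_of_tendsto hlim' ((Filter.eventually_ge_atTop 0).mono hx)
  rw [mul_zero, zero_mul, zero_add, sub_zero, mul_one, le_div_iff₀ hμ0] at hle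
  linarith


/-- Necessity for rapid stabilizability: if the system `[A,B]` is rapidly stabilizable,
then the pair `(A*, B*)` satisfies (HESI)_β for every `β > 0`. -/
theorem HESI_of_rapidly_stabilizable
    {H U : Type*}
    [NormedAddCommGroup H] [InnerProductSpace ℂ H] [CompleteSpace H]
    [TopologicalSpace.SeparableSpace H]
    [NormedAddCommGroup U] [InnerProductSpace ℂ U] [CompleteSpace U]
    [TopologicalSpace.SeparableSpace U]
    (A : H →L[ℂ] H) (B : U →L[ℂ] H)
    (hstab : ∀ α : ℝ, 0 < α → ∃ K : H →L[ℂ] U, ∃ M : ℝ, 0 < M ∧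
      ∀ t : ℝ, 0 ≤ t →
        ‖NormedSpace.exp (t • (A + B ∘L K))‖ ≤ M * Real.exp (-α * t)) :
    ∀ β : ℝ, 0 < β → ∃ C : ℝ, 0 < C ∧ ∀ lam : ℂ, -β < lam.re → ∀ φ : H,
      ‖φ‖ ^ 2 ≤ C / (lam.re + β) ^ 2 *
        (‖lam • φ - (ContinuousLinearMap.adjoint A) φ‖ ^ 2
          + ‖(ContinuousLinearMap.adjoint B) φ‖ ^ 2) := by
  intro β hβ
  obtain ⟨K, M, hM, hK⟩ := hstab β hβ
  refine ⟨M ^ 2 * (1 + ‖K‖ ^ 2), by positivity, fun lam hlam φ => ?_⟩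
  have hadj (t : ℝ) (ht : 0 ≤ t) :
      ‖NormedSpace.exp (t • ContinuousLinearMap.adjoint (A + B ∘L K))‖ ≤
        M * Real.exp (-β * t) := by
    have h : NormedSpace.exp (t • ContinuousLinearMap.adjoint (A + B ∘L K)) =
        star (NormedSpace.exp (t • (A + B ∘L K))) := by
      rw [NormedSpace.star_exp, star_smul, star_trivial, ContinuousLinearMap.star_eq_adjoint]
    rw [h, norm_star]
    exact hK t ht
  have hres := norm_le_of_norm_exp_smul_le _ hadj hlam φ
  set a := lam • φ - (ContinuousLinearMap.adjoint A) φ with ha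
  set b := (ContinuousLinearMap.adjoint B) φ with hb
  have hsplit : lam • φ - ContinuousLinearMap.adjoint (A + B ∘L K) φ =
      a - ContinuousLinearMap.adjoint K b := by
    rw [map_add, ContinuousLinearMap.adjoint_comp, add_apply,
      ContinuousLinearMap.comp_apply, ha, hb, sub_sub]
  have hnorm : ‖a - ContinuousLinearMap.adjoint K b‖ ≤ ‖a‖ + ‖K‖ * ‖b‖ := by
    refine (norm_sub_le _ _).trans ?_
    gcongr
    refine (ContinuousLinearMap.le_opNorm _ _).trans_eq ?_
    rw [LinearIsometryEquiv.norm_map]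
  have hμ : 0 < lam.re + β := by linarith
  rw [hsplit] at hres
  have hle : (lam.re + β) * ‖φ‖ ≤ M * (‖a‖ + ‖K‖ * ‖b‖) := hres.trans (by gcongr)
  have hcs : (‖a‖ + ‖K‖ * ‖b‖) ^ 2 ≤ (1 + ‖K‖ ^ 2) * (‖a‖ ^ 2 + ‖b‖ ^ 2) := by
    nlinarith [sq_nonneg (‖K‖ * ‖a‖ - ‖b‖)]
  rw [div_mul_eq_mul_div, le_div_iff₀ (by positivity)]
  calc ‖φ‖ ^ 2 * (lam.re + β) ^ 2 = ((lam.re + β) * ‖φ‖) ^ 2 := by ring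
    _ ≤ (M * (‖a‖ + ‖K‖ * ‖b‖)) ^ 2 := by gcongr
    _ = M ^ 2 * (‖a‖ + ‖K‖ * ‖b‖) ^ 2 := by ring
    _ ≤ M ^ 2 * ((1 + ‖K‖ ^ 2) * (‖a‖ ^ 2 + ‖b‖ ^ 2)) := by gcongr
    _ = _ := by ring
end

section
/- Let N be a positive integer, E ⊆ ℝ^N a thick measurable set, and R > 0. Then there exists C > 0 such that for every g ∈ L²(ℝ^N;ℂ) whose support is contained in the cube [−R,R]^N, the function f(x) := ∫_{ℝ^N} g(ξ)·e^{2πi⟨x,ξ⟩} dξ satisfies ‖f‖_{L²(ℝ^N)} ≤ C·‖f‖_{L²(E)}. -/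
open MeasureTheory Real

section Plancherel
open FourierTransform

theorem eLpNorm_fourier_eq_of_integrable_of_memLp_two {V : Type*} [NormedAddCommGroup V]
    [InnerProductSpace ℝ V] [FiniteDimensional ℝ V] [MeasurableSpace V] [BorelSpace V]
    {g : V → ℂ} (hg : Integrable g) (hg2 : MemLp g 2) :
    eLpNorm (𝓕 g) 2 volume = eLpNorm g 2 volume := by
  set G : Lp (α := V) ℂ 2 := hg2.toLp g with hG
  have hcont : Continuous (𝓕 g) :=
    VectorFourier.fourierIntegral_continuous Real.continuous_fourierChar
      (by exact continuous_inner) hg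
  have key : ∀ᵐ x, (𝓕 g) x = (𝓕 G : Lp ℂ 2 (volume : Measure V)) x := by
    refine ae_eq_of_integral_contDiff_smul_eq hcont.locallyIntegrable
      ((Lp.memLp _).locallyIntegrable (by norm_num)) fun φ hφ hφc => ?_
    have h1 : HasCompactSupport (Complex.ofRealCLM ∘ φ) := hφc.comp_left rfl
    have h2 : ContDiff ℝ (⊤ : ℕ∞) (Complex.ofRealCLM ∘ φ) := by fun_prop
    set Φ : SchwartzMap V ℂ := h1.toSchwartzMap h2 with hΦ
    have hΦx : ∀ x, Φ x = (φ x : ℂ) := fun x => rfl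
    have e1 := congrArg (fun T => T Φ) (Lp.fourier_toTemperedDistribution_eq G)
    simp only [TemperedDistribution.fourier_apply, Lp.toTemperedDistribution_apply] at e1
    have e2 : ∫ x, (𝓕 Φ) x • G x = ∫ x, (𝓕 Φ) x • g x := by
      refine integral_congr_ae ?_
      filter_upwards [hg2.coeFn_toLp] with x hx
      rw [hx]
    have e3 : ∫ x, (𝓕 Φ) x • g x = ∫ x, Φ x • (𝓕 g) x := by
      have := VectorFourier.integral_fourierIntegral_smul_eq_flip (μ := (volume : Measure V))
        (ν := (volume : Measure V)) (L := innerₗ V) Real.continuous_fourierChar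
        (by exact continuous_inner) (Φ.integrable) hg
      rw [flip_innerₗ] at this
      exact this
    calc ∫ x, φ x • (𝓕 g) x = ∫ x, Φ x • (𝓕 g) x := by simp [hΦx]
      _ = ∫ x, Φ x • (𝓕 G : Lp ℂ 2 (volume : Measure V)) x := by rw [← e3, ← e2, e1]
      _ = _ := by simp [hΦx]
  rw [eLpNorm_congr_ae key]
  have h3 := Lp.norm_fourier_eq G
  rw [Lp.norm_def, Lp.norm_def, ENNReal.toReal_eq_toReal_iff' (Lp.eLpNorm_ne_top _)
    (Lp.eLpNorm_ne_top _)] at h3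
  rw [h3, eLpNorm_congr_ae hg2.coeFn_toLp]

theorem eLpNorm_integral_mul_cexp_eq {N : ℕ} {g : (Fin N → ℝ) → ℂ} (hg : Integrable g)
    (hg2 : MemLp g 2) :
    eLpNorm (fun x : Fin N → ℝ => ∫ ξ : Fin N → ℝ, g ξ *
      Complex.exp (2 * π * Complex.I * ((∑ i, x i * ξ i : ℝ) : ℂ))) 2 volume
      = eLpNorm g 2 volume := by
  have mp := PiLp.volume_preserving_ofLp (Fin N)
  have mpt := PiLp.volume_preserving_toLp (Fin N)
  set e := MeasurableEquiv.toLp 2 (Fin N → ℝ) with he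
  set G : EuclideanSpace ℝ (Fin N) → ℂ := fun v => g (WithLp.ofLp v) with hGdef
  have hG : Integrable G := (mp.integrable_comp_emb e.symm.measurableEmbedding).2 hg
  have hG2 : MemLp G 2 := hg2.comp_measurePreserving mp
  have h1 : eLpNorm G 2 volume = eLpNorm g 2 volume :=
    eLpNorm_comp_measurePreserving hg2.1 mp
  have hcont : Continuous (𝓕 G) :=
    VectorFourier.fourierIntegral_continuous Real.continuous_fourierChar
      (by exact continuous_inner) hG
  rw [← h1, ← eLpNorm_fourier_eq_of_integrable_of_memLp_two hG hG2]
  rw [← eLpNorm_comp_measurePreserving hcont.aestronglyMeasurable mpt]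
  rw [← eLpNorm_comp_measurePreserving (f := Neg.neg) (g := 𝓕 G ∘ WithLp.toLp 2)
    ((hcont.comp (PiLp.continuous_toLp 2 _)).aestronglyMeasurable)
    (Measure.measurePreserving_neg (volume : Measure (Fin N → ℝ)))]
  congr 1
  ext x
  simp only [Function.comp_apply, Real.fourier_eq']
  rw [← mp.integral_comp e.symm.measurableEmbedding]
  refine integral_congr_ae (Filter.Eventually.of_forall fun v => ?_)
  simp only [hGdef, smul_eq_mul, PiLp.inner_apply]
  rw [mul_comm]
  congr 2
  simp
  ring

end Plancherel

section PowerSeries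
open Set Filter Topology

/-- The exponential power series `∑ aₖ zᵏ / k!` with coefficient sequence `a`. -/
noncomputable def expSeries (a : ℕ → ℂ) (z : ℂ) : ℂ := ∑' k, a k * z ^ k / (k.factorial : ℂ)

theorem norm_expSeries_term_le {a : ℕ → ℂ} {C B r : ℝ} (ha : ∀ k, ‖a k‖ ≤ C * B ^ k) {z : ℂ}
    (hz : ‖z‖ ≤ r) (k : ℕ) :
    ‖a k * z ^ k / (k.factorial : ℂ)‖ ≤ C * ((B * r) ^ k / k.factorial) := by
  have h0 : 0 ≤ C * B ^ k := (norm_nonneg _).trans (ha k)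
  rw [norm_div, norm_mul, norm_pow, Complex.norm_natCast, mul_pow, ← mul_div_assoc, ← mul_assoc]
  gcongr
  exact ha k

theorem summable_mul_pow_div_factorial (C x : ℝ) :
    Summable fun k : ℕ => C * (x ^ k / k.factorial) :=
  (Real.summable_pow_div_factorial x).mul_left C

theorem differentiable_expSeries {a : ℕ → ℂ} {C B : ℝ} (ha : ∀ k, ‖a k‖ ≤ C * B ^ k) :
    Differentiable ℂ (expSeries a) := by
  intro z
  have h : DifferentiableOn ℂ (expSeries a) (Metric.ball 0 (‖z‖ + 1)) :=
    Complex.differentiableOn_tsum_of_summable_norm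
      (summable_mul_pow_div_factorial C (B * (‖z‖ + 1))) (fun k => by fun_prop)
      Metric.isOpen_ball fun k w hw => norm_expSeries_term_le ha (mem_ball_zero_iff.1 hw).le k
  exact h.differentiableAt (Metric.isOpen_ball.mem_nhds (by simp))

theorem expSeries_zero (a : ℕ → ℂ) : expSeries a 0 = a 0 := by
  rw [expSeries, tsum_eq_single 0 (fun k hk => by simp [hk])]
  simp

theorem volume_zeros_expSeries {a : ℕ → ℂ} {C B : ℝ} (ha : ∀ k, ‖a k‖ ≤ C * B ^ k)
    (h0 : a 0 = 1) : volume {t : ℝ | t ∈ Icc (0 : ℝ) 1 ∧ expSeries a t = 0} = 0 := by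
  have han : AnalyticOnNhd ℂ (expSeries a) univ :=
    (differentiable_expSeries ha).differentiableOn.analyticOnNhd isOpen_univ
  have h1 : expSeries a ⁻¹' {0}ᶜ ∈ codiscrete ℂ :=
    han.preimage_zero_mem_codiscrete (x := 0) (by rw [expSeries_zero, h0]; exact one_ne_zero)
  have h2 := (isCompact_closedBall (0 : ℂ) 1).finite_sdiff_of_mem_codiscreteWithin
    (Filter.codiscreteWithin_mono (subset_univ _) h1)
  refine ((h2.preimage (Complex.ofReal_injective.injOn)).subset ?_).measure_zero _
  rintro t ⟨⟨h3, h4⟩, h5⟩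
  simp [h5, abs_of_nonneg h3, h4]

theorem exists_volume_sublevel_expSeries_lt {a : ℕ → ℂ} {C B : ℝ} (ha : ∀ k, ‖a k‖ ≤ C * B ^ k)
    (h0 : a 0 = 1) {η : ENNReal} (hη : 0 < η) :
    ∃ δ : ℝ, 0 < δ ∧ volume {t : ℝ | t ∈ Icc (0 : ℝ) 1 ∧ ‖expSeries a t‖ ≤ δ} < η := by
  have hc : Continuous fun t : ℝ => ‖expSeries a t‖ :=
    ((differentiable_expSeries ha).continuous.comp Complex.continuous_ofReal).norm
  set s : ℕ → Set ℝ := fun n => {t | t ∈ Icc (0 : ℝ) 1 ∧ ‖expSeries a t‖ ≤ 1 / ((n : ℝ) + 1)}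
    with hs
  have hm : ∀ n, MeasurableSet (s n) := fun n =>
    measurableSet_Icc.inter (measurableSet_le hc.measurable measurable_const)
  have hanti : Antitone s := fun m n hmn t ht =>
    ⟨ht.1, ht.2.trans (one_div_le_one_div_of_le (by positivity) (by gcongr))⟩
  have ht := tendsto_measure_iInter_atTop (μ := volume) (fun n => (hm n).nullMeasurableSet) hanti
    ⟨0, ((measure_mono fun t ht => ht.1).trans_lt (by simp : volume (Icc (0:ℝ) 1) < ⊤)).ne⟩
  have hz : volume (⋂ n, s n) = 0 := by
    refine measure_mono_null (fun t ht => ?_) (volume_zeros_expSeries ha h0)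
    rw [mem_iInter] at ht
    refine ⟨(ht 0).1, norm_le_zero_iff.1 ?_⟩
    exact ge_of_tendsto' tendsto_one_div_add_atTop_nhds_zero_nat fun n => (ht n).2
  rw [hz] at ht
  obtain ⟨n, hn⟩ := (ht.eventually_lt_const hη).exists
  exact ⟨1 / ((n : ℝ) + 1), by positivity, hn⟩

/-- A power series normalized to be `1` at the origin, with coefficients under uniform control,
is bounded below on the unit interval off a set of small measure, uniformly in the series. -/
theorem exists_uniform_volume_sublevel_expSeries_le (C B : ℝ) {η : ENNReal} (hη : 0 < η) :
    ∃ δ : ℝ, 0 < δ ∧ ∀ a : ℕ → ℂ, a 0 = 1 → (∀ k, ‖a k‖ ≤ C * B ^ k) →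
      volume {t : ℝ | t ∈ Icc (0 : ℝ) 1 ∧ ‖expSeries a t‖ < δ} ≤ η := by
  set K : Set (ℕ → ℂ) := univ.pi fun k => Metric.closedBall 0 (C * B ^ k) with hK
  have hKmem : ∀ a, a ∈ K ↔ ∀ k, ‖a k‖ ≤ C * B ^ k := fun a => by simp [hK, Set.mem_pi]
  have hKc : IsCompact K := isCompact_univ_pi fun k => isCompact_closedBall _ _
  have hK1 : IsCompact (K ∩ {a | a 0 = 1}) :=
    hKc.inter_right (isClosed_eq (continuous_apply 0) continuous_const)
  suffices h : ∃ δ : ℝ, 0 < δ ∧ ∀ a ∈ K ∩ {a | a 0 = 1},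
      volume {t : ℝ | t ∈ Icc (0 : ℝ) 1 ∧ ‖expSeries a t‖ < δ} ≤ η by
    obtain ⟨δ, h1, h2⟩ := h
    exact ⟨δ, h1, fun a h3 h4 => h2 a ⟨(hKmem a).2 h4, h3⟩⟩
  refine hK1.induction_on (p := fun S => ∃ δ : ℝ, 0 < δ ∧ ∀ a ∈ S,
      volume {t : ℝ | t ∈ Icc (0 : ℝ) 1 ∧ ‖expSeries a t‖ < δ} ≤ η) ⟨1, one_pos, by simp⟩ ?_ ?_ ?_
  · rintro S T hST ⟨δ, h1, h2⟩
    exact ⟨δ, h1, fun a ha => h2 a (hST ha)⟩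
  · rintro S T ⟨δ, h1, h2⟩ ⟨δ', h1', h2'⟩
    refine ⟨min δ δ', lt_min h1 h1', ?_⟩
    rintro a (ha | ha)
    · refine (measure_mono ?_).trans (h2 a ha)
      exact fun t ht => ⟨ht.1, ht.2.trans_le (min_le_left _ _)⟩
    · refine (measure_mono ?_).trans (h2' a ha)
      exact fun t ht => ⟨ht.1, ht.2.trans_le (min_le_right _ _)⟩
  · rintro a ⟨haK, ha0⟩
    have ha := (hKmem a).1 haK
    obtain ⟨δ, hδ, hlt⟩ := exists_volume_sublevel_expSeries_lt ha ha0 hη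
    set D : (ℕ → ℂ) → ℝ := fun b => ∑' k : ℕ, ‖b k - a k‖ / k.factorial with hD
    have hbound : ∀ (k : ℕ), ∀ b ∈ K,
        ‖‖b k - a k‖ / (k.factorial : ℝ)‖ ≤ 2 * C * (B ^ k / k.factorial) := fun k b hb => by
      rw [Real.norm_of_nonneg (by positivity), ← mul_div_assoc]
      gcongr
      linarith [norm_sub_le (b k) (a k), (hKmem b).1 hb k, ha k]
    have hDc : ContinuousOn D K :=
      continuousOn_tsum (fun k => by fun_prop) (summable_mul_pow_div_factorial (2 * C) B) hbound
    have hDa : D a = 0 := by simp [hD]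
    have hev : ∀ᶠ b in 𝓝[K] a, D b < δ / 2 :=
      (hDc a haK).eventually_lt_const (by rw [hDa]; positivity)
    refine ⟨K ∩ {b | D b < δ / 2}, ?_, δ / 2, half_pos hδ, ?_⟩
    · exact nhdsWithin_mono a inter_subset_left (inter_mem self_mem_nhdsWithin hev)
    · rintro b ⟨hbK, hbD⟩
      refine (measure_mono ?_).trans hlt.le
      rintro t ⟨ht, hbt⟩
      refine ⟨ht, ?_⟩
      have ht1 : ‖(t : ℂ)‖ ≤ 1 := by simpa [abs_of_nonneg ht.1] using ht.2
      have hsa : Summable fun k : ℕ => a k * (t : ℂ) ^ k / (k.factorial : ℂ) :=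
        .of_norm_bounded (summable_mul_pow_div_factorial C (B * 1)) (norm_expSeries_term_le ha ht1)
      have hsb : Summable fun k : ℕ => b k * (t : ℂ) ^ k / (k.factorial : ℂ) :=
        .of_norm_bounded (summable_mul_pow_div_factorial C (B * 1))
          (norm_expSeries_term_le ((hKmem b).1 hbK) ht1)
      have hdiff : ‖expSeries b t - expSeries a t‖ ≤ D b := by
        rw [expSeries, expSeries, ← hsb.tsum_sub hsa]
        refine tsum_of_norm_bounded (Summable.hasSum (.of_norm_bounded
          (summable_mul_pow_div_factorial (2 * C) B) fun k => hbound k b hbK)) fun k => ?_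
        rw [← sub_div, ← sub_mul, norm_div, norm_mul, norm_pow, Complex.norm_natCast]
        gcongr
        exact mul_le_of_le_one_right (norm_nonneg _) (pow_le_one₀ (norm_nonneg _) ht1)
      have : ‖expSeries a t‖ ≤ ‖expSeries b t - expSeries a t‖ + ‖expSeries b t‖ := by
        rw [norm_sub_rev]
        simpa using norm_add_le (expSeries a t - expSeries b t) (expSeries b t)
      have hbD' : D b < δ / 2 := hbD
      linarith

end PowerSeries

section Transfer
open Set Filter Topology

/-- If the coefficients `a k` are controlled in `L²` by a geometric multiple of `a 0`, then the
portion of the `L²` mass of `a 0` where the associated power series has many small values is small. -/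
theorem exists_lintegral_mul_volume_sublevel_expSeries_le {B θ : ℝ} (hB : 0 < B) (hθ : 0 < θ) :
    ∃ δ : ℝ, 0 < δ ∧ ∀ {X : Type} [MeasurableSpace X] (μ : Measure X) (a : ℕ → X → ℂ),
      (∀ k, AEMeasurable (a k) μ) →
      (∀ k, ∫⁻ x, ‖a k x‖ₑ ^ 2 ∂μ ≤ ENNReal.ofReal (B ^ k) ^ 2 * ∫⁻ x, ‖a 0 x‖ₑ ^ 2 ∂μ) →
      ∫⁻ x, ‖a 0 x‖ₑ ^ 2 * volume {t : ℝ | t ∈ Icc (0 : ℝ) 1 ∧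
          ‖expSeries (fun k => a k x) t‖ < δ * ‖a 0 x‖} ∂μ
        ≤ ENNReal.ofReal (2 * θ) * ∫⁻ x, ‖a 0 x‖ₑ ^ 2 ∂μ := by
  set C : ℝ := √(2 / θ) with hC
  have hC0 : 0 < C := by positivity
  have hC2 : C ^ 2 = 2 / θ := Real.sq_sqrt (by positivity)
  obtain ⟨δ, hδ, hvol⟩ := exists_uniform_volume_sublevel_expSeries_le C (2 * B)
    (ENNReal.ofReal_pos.2 hθ)
  refine ⟨δ, hδ, fun {X} _ μ a ham hak => ?_⟩
  set W := ∫⁻ x, ‖a 0 x‖ₑ ^ 2 ∂μ with hW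
  set w : ℕ → ENNReal := fun k => ENNReal.ofReal (C * (2 * B) ^ k)⁻¹ ^ 2 with hw
  have hpt : ∀ x, ‖a 0 x‖ₑ ^ 2 * volume {t : ℝ | t ∈ Icc (0 : ℝ) 1 ∧
      ‖expSeries (fun k => a k x) t‖ < δ * ‖a 0 x‖}
      ≤ ENNReal.ofReal θ * ‖a 0 x‖ₑ ^ 2 + ∑' k, w k * ‖a k x‖ₑ ^ 2 := by
    intro x
    by_cases h0 : a 0 x = 0
    · simp [h0]
    have h0' : 0 < ‖a 0 x‖ := norm_pos_iff.2 h0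
    by_cases hgood : ∀ k, ‖a k x‖ ≤ C * (2 * B) ^ k * ‖a 0 x‖
    · refine le_add_right ?_
      rw [mul_comm]
      gcongr
      refine (measure_mono ?_).trans (hvol (fun k => a k x / a 0 x) (div_self h0) fun k => ?_)
      · rintro t ⟨ht, hlt⟩
        refine ⟨ht, ?_⟩
        have : expSeries (fun k => a k x / a 0 x) t = expSeries (fun k => a k x) t / a 0 x := by
          rw [expSeries, expSeries, ← tsum_div_const]
          exact tsum_congr fun k => by ring
        rw [this, norm_div, div_lt_iff₀ h0']
        exact hlt
      · rw [norm_div, div_le_iff₀ h0']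
        exact hgood k
    · push Not at hgood
      obtain ⟨k, hk⟩ := hgood
      have hv : volume {t : ℝ | t ∈ Icc (0 : ℝ) 1 ∧
          ‖expSeries (fun k => a k x) t‖ < δ * ‖a 0 x‖} ≤ 1 :=
        (measure_mono fun t ht => ht.1).trans (by simp : volume (Icc (0:ℝ) 1) ≤ 1)
      have hle : ‖a 0 x‖ₑ ≤ ENNReal.ofReal (C * (2 * B) ^ k)⁻¹ * ‖a k x‖ₑ := by
        rw [← ofReal_norm, ← ofReal_norm, ← ENNReal.ofReal_mul (by positivity)]
        refine ENNReal.ofReal_le_ofReal ?_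
        rw [← div_eq_inv_mul, le_div_iff₀ (by positivity), mul_comm]
        exact hk.le
      calc _ ≤ ‖a 0 x‖ₑ ^ 2 * 1 := by gcongr
        _ ≤ (ENNReal.ofReal (C * (2 * B) ^ k)⁻¹ * ‖a k x‖ₑ) ^ 2 := by rw [mul_one]; gcongr
        _ = w k * ‖a k x‖ₑ ^ 2 := by rw [mul_pow]
        _ ≤ ∑' k, w k * ‖a k x‖ₑ ^ 2 := ENNReal.le_tsum k
        _ ≤ _ := le_add_self
  have hwk : ∀ k, w k * ENNReal.ofReal (B ^ k) ^ 2 = ENNReal.ofReal (θ / 2 * (1 / 4) ^ k) := by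
    intro k
    rw [hw, ← mul_pow, ← ENNReal.ofReal_mul (by positivity), ← ENNReal.ofReal_pow (by positivity)]
    congr 1
    have h4 : (4 : ℝ) ^ k = (2 ^ k) ^ 2 := by rw [← pow_mul, mul_comm, pow_mul]; norm_num
    rw [one_div, inv_pow, h4, mul_pow, mul_pow, inv_pow, mul_pow, hC2]
    field_simp
  have hsum : ∑' k, w k * ENNReal.ofReal (B ^ k) ^ 2 ≤ ENNReal.ofReal θ := by
    simp_rw [hwk]
    have hs : HasSum (fun k : ℕ => θ / 2 * (1 / 4 : ℝ) ^ k) (θ / 2 * (1 - 1 / 4)⁻¹) :=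
      (hasSum_geometric_of_lt_one (by norm_num) (by norm_num)).mul_left _
    rw [← ENNReal.ofReal_tsum_of_nonneg (fun k => by positivity) hs.summable, hs.tsum_eq]
    exact ENNReal.ofReal_le_ofReal (by norm_num; linarith)
  calc _ ≤ ∫⁻ x, ENNReal.ofReal θ * ‖a 0 x‖ₑ ^ 2 + ∑' k, w k * ‖a k x‖ₑ ^ 2 ∂μ :=
        lintegral_mono hpt
    _ = ENNReal.ofReal θ * W + ∑' k, w k * ∫⁻ x, ‖a k x‖ₑ ^ 2 ∂μ := by
        rw [lintegral_add_left' (((ham 0).enorm.pow_const 2).const_mul _),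
          lintegral_const_mul'' _ ((ham 0).enorm.pow_const 2),
          lintegral_tsum fun k => ((ham k).enorm.pow_const 2).const_mul _]
        simp_rw [fun k => lintegral_const_mul'' (w k) ((ham k).enorm.pow_const 2)]
        rfl
    _ ≤ ENNReal.ofReal θ * W + ∑' k, w k * (ENNReal.ofReal (B ^ k) ^ 2 * W) := by
        gcongr with k
        exact hak k
    _ = ENNReal.ofReal θ * W + (∑' k, w k * ENNReal.ofReal (B ^ k) ^ 2) * W := by
        simp_rw [← mul_assoc, ENNReal.tsum_mul_right]
    _ ≤ ENNReal.ofReal θ * W + ENNReal.ofReal θ * W := by gcongr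
    _ = _ := by rw [← add_mul, ← ENNReal.ofReal_add hθ.le hθ.le, two_mul]

end Transfer

section BandLimited

/-- The function with Fourier transform `g`. -/
noncomputable def fourierSynthesis {N : ℕ} (g : (Fin N → ℝ) → ℂ) (x : Fin N → ℝ) : ℂ :=
  ∫ ξ : Fin N → ℝ, g ξ * Complex.exp (2 * π * Complex.I * ((∑ i, x i * ξ i : ℝ) : ℂ))

variable {N : ℕ} {g : (Fin N → ℝ) → ℂ} {y : Fin N → ℝ} {B : ℝ}

theorem norm_cexp_two_pi_I_mul_ofReal (r : ℝ) :
    ‖Complex.exp (2 * π * Complex.I * (r : ℂ))‖ = 1 := by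
  have : 2 * (π : ℂ) * Complex.I * (r : ℂ) = ((2 * π * r : ℝ) : ℂ) * Complex.I := by
    push_cast; ring
  rw [this, Complex.norm_exp_ofReal_mul_I]

theorem continuous_fourierSynthesis (hg : Integrable g) : Continuous (fourierSynthesis g) := by
  refine continuous_of_dominated (bound := fun ξ => ‖g ξ‖) (fun x => ?_) (fun x => ?_) hg.norm ?_
  · exact hg.1.mul (Continuous.aestronglyMeasurable (by fun_prop))
  · refine Filter.Eventually.of_forall fun ξ => ?_
    rw [norm_mul, norm_cexp_two_pi_I_mul_ofReal, mul_one]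
  · exact Filter.Eventually.of_forall fun ξ => by fun_prop

theorem norm_mul_two_pi_I_sum_pow_le (hB : ∀ ξ, g ξ ≠ 0 → 2 * π * |∑ i, y i * ξ i| ≤ B)
    (k : ℕ) (ξ : Fin N → ℝ) :
    ‖g ξ * (2 * π * Complex.I * ((∑ i, y i * ξ i : ℝ) : ℂ)) ^ k‖ ≤ B ^ k * ‖g ξ‖ := by
  by_cases h : g ξ = 0
  · simp [h]
  have h1 : ‖2 * (π : ℂ) * Complex.I * ((∑ i, y i * ξ i : ℝ) : ℂ)‖ ≤ B := by
    simpa [-Complex.ofReal_sum, -Complex.ofReal_mul, abs_of_pos pi_pos] using hB ξ h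
  rw [norm_mul, norm_pow, mul_comm]
  gcongr

theorem aestronglyMeasurable_mul_two_pi_I_sum_pow (hg : AEStronglyMeasurable g) (y : Fin N → ℝ)
    (k : ℕ) : AEStronglyMeasurable
      (fun ξ => g ξ * (2 * π * Complex.I * ((∑ i, y i * ξ i : ℝ) : ℂ)) ^ k) volume :=
  hg.mul (Continuous.aestronglyMeasurable (by fun_prop))

theorem integrable_mul_two_pi_I_sum_pow (hg : Integrable g)
    (hB : ∀ ξ, g ξ ≠ 0 → 2 * π * |∑ i, y i * ξ i| ≤ B) (k : ℕ) :
    Integrable fun ξ => g ξ * (2 * π * Complex.I * ((∑ i, y i * ξ i : ℝ) : ℂ)) ^ k :=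
  (hg.norm.const_mul (B ^ k)).mono' (aestronglyMeasurable_mul_two_pi_I_sum_pow hg.1 y k)
    (Filter.Eventually.of_forall (norm_mul_two_pi_I_sum_pow_le hB k))

theorem eLpNorm_fourierSynthesis (hg : Integrable g) (hg2 : MemLp g 2) :
    eLpNorm (fourierSynthesis g) 2 volume = eLpNorm g 2 volume :=
  eLpNorm_integral_mul_cexp_eq hg hg2

/-- Bernstein's inequality for the iterated derivatives of a band-limited function along `y`. -/
theorem eLpNorm_fourierSynthesis_mul_pow_le (hg : Integrable g) (hg2 : MemLp g 2)
    (hB : ∀ ξ, g ξ ≠ 0 → 2 * π * |∑ i, y i * ξ i| ≤ B) (k : ℕ) :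
    eLpNorm (fourierSynthesis fun ξ =>
        g ξ * (2 * π * Complex.I * ((∑ i, y i * ξ i : ℝ) : ℂ)) ^ k) 2 volume
      ≤ ENNReal.ofReal (B ^ k) * eLpNorm (fourierSynthesis g) 2 volume := by
  have hle := norm_mul_two_pi_I_sum_pow_le hB k
  rw [eLpNorm_fourierSynthesis hg hg2,
    eLpNorm_fourierSynthesis (integrable_mul_two_pi_I_sum_pow hg hB k)
      (hg2.of_le_mul (aestronglyMeasurable_mul_two_pi_I_sum_pow hg.1 y k)
        (Filter.Eventually.of_forall hle))]
  exact eLpNorm_le_mul_eLpNorm_of_ae_le_mul (Filter.Eventually.of_forall hle) 2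

/-- Taylor expansion of a band-limited function along `y`. -/
theorem fourierSynthesis_add_smul (hg : Integrable g)
    (hB : ∀ ξ, g ξ ≠ 0 → 2 * π * |∑ i, y i * ξ i| ≤ B) (x : Fin N → ℝ) (t : ℝ) :
    fourierSynthesis g (x + t • y) = expSeries (fun k => fourierSynthesis (fun ξ =>
      g ξ * (2 * π * Complex.I * ((∑ i, y i * ξ i : ℝ) : ℂ)) ^ k) x) t := by
  set e : (Fin N → ℝ) → ℂ := fun ξ =>
    Complex.exp (2 * π * Complex.I * ((∑ i, x i * ξ i : ℝ) : ℂ)) with he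
  set p : (Fin N → ℝ) → ℂ := fun ξ => 2 * π * Complex.I * ((∑ i, y i * ξ i : ℝ) : ℂ) with hp
  have he1 : ∀ ξ, ‖e ξ‖ = 1 := fun ξ => norm_cexp_two_pi_I_mul_ofReal _
  set F : ℕ → (Fin N → ℝ) → ℂ := fun k ξ => g ξ * p ξ ^ k * e ξ * ((t : ℂ) ^ k / k.factorial)
    with hF
  have hint : ∀ k, Integrable (fun ξ => g ξ * p ξ ^ k * e ξ) := fun k => by
    have hk := integrable_mul_two_pi_I_sum_pow hg hB k
    refine hk.norm.mono' (hk.1.mul (Continuous.aestronglyMeasurable (by fun_prop)))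
      (Filter.Eventually.of_forall fun ξ => ?_)
    rw [norm_mul, he1, mul_one]
  have hFint : ∀ k, Integrable (F k) := fun k => (hint k).mul_const _
  have hFle : ∀ k, ∫ ξ, ‖F k ξ‖ ≤ (∫ ξ, ‖g ξ‖) * ((B * |t|) ^ k / k.factorial) := fun k => by
    rw [← integral_mul_const]
    refine integral_mono (hFint k).norm (hg.norm.mul_const _) fun ξ => ?_
    have := norm_mul_two_pi_I_sum_pow_le hB k ξ
    simp only [hF, norm_mul (g ξ * p ξ ^ k * e ξ), norm_mul (g ξ * p ξ ^ k), he1, mul_one, norm_div,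
      norm_pow, Complex.norm_natCast, Complex.norm_real, Real.norm_eq_abs]
    calc _ ≤ B ^ k * ‖g ξ‖ * (|t| ^ k / k.factorial) := by gcongr
      _ = _ := by rw [mul_pow]; ring
  have hsum := hasSum_integral_of_summable_integral_norm hFint
    (.of_nonneg_of_le (fun k => integral_nonneg fun _ => norm_nonneg _) hFle
      (summable_mul_pow_div_factorial _ _))
  have hFk : ∀ k, ∫ ξ, F k ξ = fourierSynthesis (fun ξ => g ξ * p ξ ^ k) x * (t : ℂ) ^ k /
      (k.factorial : ℂ) := fun k => by
    rw [hF, integral_mul_const, mul_div_assoc]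
    rfl
  rw [expSeries, ← tsum_congr hFk, hsum.tsum_eq, fourierSynthesis]
  refine integral_congr_ae (Filter.Eventually.of_forall fun ξ => ?_)
  have hexp : HasSum (fun k : ℕ => ((t : ℂ) * p ξ) ^ k / k.factorial) (Complex.exp (t * p ξ)) := by
    rw [Complex.exp_eq_exp_ℂ]
    exact NormedSpace.expSeries_div_hasSum_exp _
  have h2 : ∑' k, F k ξ = g ξ * e ξ * Complex.exp (t * p ξ) := by
    rw [← (hexp.mul_left (g ξ * e ξ)).tsum_eq]
    exact tsum_congr fun k => by simp only [hF, mul_pow]; ring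
  simp only [h2]
  rw [mul_assoc (g ξ) (e ξ), he, ← Complex.exp_add]
  congr 2
  simp only [hp, Pi.add_apply, Pi.smul_apply, smul_eq_mul, add_mul, Finset.sum_add_distrib,
    mul_assoc, ← Finset.mul_sum]
  push_cast
  ring

end BandLimited

section Thick
open Set

/-- Averaging over dilations: the part of a set in a cube is controlled by the length of its
intersections with the segments issued from the origin. -/
theorem volume_inter_cube_le {N : ℕ} {S : Set (Fin N → ℝ)} (hS : MeasurableSet S) (r : ℝ) :
    volume (S ∩ Metric.closedBall 0 r) ≤ 2 * ∫⁻ y in Metric.closedBall 0 (2 * r),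
      volume {t : ℝ | t ∈ Icc (0 : ℝ) 1 ∧ t • y ∈ S} := by
  set T : Set ((Fin N → ℝ) × ℝ) := {p | p.2 ∈ Icc (0 : ℝ) 1 ∧ p.2 • p.1 ∈ S} with hT
  have hTm : MeasurableSet T :=
    (measurable_snd measurableSet_Icc).inter ((by fun_prop : Measurable
      fun p : (Fin N → ℝ) × ℝ => p.2 • p.1) hS)
  have hswap : ∫⁻ y in Metric.closedBall (0 : Fin N → ℝ) (2 * r),
      volume {t : ℝ | t ∈ Icc (0 : ℝ) 1 ∧ t • y ∈ S}
      = ∫⁻ t : ℝ, (volume.restrict (Metric.closedBall (0 : Fin N → ℝ) (2 * r)))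
          ((fun y => (y, t)) ⁻¹' T) := by
    rw [← Measure.prod_apply_symm hTm, Measure.prod_apply hTm]
    rfl
  have hmain : ∀ t ∈ Icc (1 / 2 : ℝ) 1, volume (S ∩ Metric.closedBall 0 r) ≤
      (volume.restrict (Metric.closedBall (0 : Fin N → ℝ) (2 * r))) ((fun y => (y, t)) ⁻¹' T) := by
    rintro t ⟨ht1, ht2⟩
    have ht0 : 0 < t := by linarith
    rw [Measure.restrict_apply (hTm.preimage (by fun_prop))]
    calc volume (S ∩ Metric.closedBall 0 r)
        ≤ ENNReal.ofReal |(t ^ Module.finrank ℝ (Fin N → ℝ))⁻¹| *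
          volume (S ∩ Metric.closedBall 0 r) := by
          refine le_mul_of_one_le_left' (ENNReal.one_le_ofReal.2 ?_)
          rw [abs_of_pos (by positivity)]
          exact (one_le_inv₀ (by positivity)).2 (pow_le_one₀ ht0.le ht2)
      _ = volume ((t • ·) ⁻¹' (S ∩ Metric.closedBall 0 r)) :=
          (Measure.addHaar_preimage_smul _ ht0.ne' _).symm
      _ ≤ _ := by
          refine measure_mono ?_
          rintro y ⟨h1, h2⟩
          refine ⟨⟨⟨ht0.le, ht2⟩, h1⟩, ?_⟩
          rw [mem_closedBall_zero_iff, norm_smul, Real.norm_of_nonneg ht0.le] at h2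
          rw [mem_closedBall_zero_iff]
          nlinarith [norm_nonneg y]
  rw [hswap]
  have hhalf : volume (S ∩ Metric.closedBall 0 r) * ENNReal.ofReal (1 / 2) ≤
      ∫⁻ t : ℝ, (volume.restrict (Metric.closedBall (0 : Fin N → ℝ) (2 * r)))
          ((fun y => (y, t)) ⁻¹' T) := by
    calc _ = ∫⁻ t in Icc (1 / 2 : ℝ) 1, volume (S ∩ Metric.closedBall 0 r) := by
          rw [setLIntegral_const, Real.volume_Icc]
          norm_num
      _ ≤ ∫⁻ t in Icc (1 / 2 : ℝ) 1,
            (volume.restrict (Metric.closedBall (0 : Fin N → ℝ) (2 * r)))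
              ((fun y => (y, t)) ⁻¹' T) := setLIntegral_mono' measurableSet_Icc hmain
      _ ≤ _ := setLIntegral_le_lintegral _ _
  calc _ = 2 * (volume (S ∩ Metric.closedBall 0 r) * ENNReal.ofReal (1 / 2)) := by
        rw [mul_comm, mul_assoc, one_div, ENNReal.ofReal_inv_of_pos two_pos, ENNReal.ofReal_ofNat,
          ENNReal.inv_mul_cancel (by norm_num) (by norm_num), mul_one]
    _ ≤ _ := by gcongr

theorem lintegral_mul_volume_small_le {N : ℕ} {f : (Fin N → ℝ) → ℂ} (hf : Continuous f)
    (δ r : ℝ) {κ : ENNReal}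
    (h : ∀ y ∈ Metric.closedBall (0 : Fin N → ℝ) (2 * r),
      ∫⁻ x, ‖f x‖ₑ ^ 2 * volume {t : ℝ | t ∈ Icc (0 : ℝ) 1 ∧ ‖f (x + t • y)‖ < δ * ‖f x‖} ≤ κ) :
    ∫⁻ x, ‖f x‖ₑ ^ 2 * volume ({y | ‖f (x + y)‖ < δ * ‖f x‖} ∩ Metric.closedBall 0 r)
      ≤ 2 * (κ * volume (Metric.closedBall (0 : Fin N → ℝ) (2 * r))) := by
  have hmeas : Measurable fun p : (Fin N → ℝ) × (Fin N → ℝ) => ‖f p.1‖ₑ ^ 2 *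
      volume {t : ℝ | t ∈ Icc (0 : ℝ) 1 ∧ ‖f (p.1 + t • p.2)‖ < δ * ‖f p.1‖} := by
    refine (hf.measurable.comp measurable_fst).enorm.pow_const 2 |>.mul ?_
    have hlt : MeasurableSet {q : ((Fin N → ℝ) × (Fin N → ℝ)) × ℝ |
        ‖f (q.1.1 + q.2 • q.1.2)‖ < δ * ‖f q.1.1‖} :=
      (isOpen_lt (by fun_prop) (by fun_prop)).measurableSet
    have hm : MeasurableSet {q : ((Fin N → ℝ) × (Fin N → ℝ)) × ℝ | q.2 ∈ Icc (0 : ℝ) 1 ∧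
        ‖f (q.1.1 + q.2 • q.1.2)‖ < δ * ‖f q.1.1‖} :=
      (measurable_snd measurableSet_Icc).inter hlt
    exact measurable_measure_prodMk_left hm
  calc _ ≤ ∫⁻ x, 2 * ∫⁻ y in Metric.closedBall (0 : Fin N → ℝ) (2 * r), ‖f x‖ₑ ^ 2 *
          volume {t : ℝ | t ∈ Icc (0 : ℝ) 1 ∧ ‖f (x + t • y)‖ < δ * ‖f x‖} := by
        refine lintegral_mono fun x => ?_
        rw [lintegral_const_mul' _ _ (by finiteness), mul_left_comm]
        gcongr
        exact volume_inter_cube_le (isOpen_lt (by fun_prop) (by fun_prop)).measurableSet r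
    _ = 2 * ∫⁻ y in Metric.closedBall (0 : Fin N → ℝ) (2 * r), ∫⁻ x, ‖f x‖ₑ ^ 2 *
          volume {t : ℝ | t ∈ Icc (0 : ℝ) 1 ∧ ‖f (x + t • y)‖ < δ * ‖f x‖} := by
        rw [lintegral_const_mul' _ _ (by norm_num), lintegral_lintegral_swap hmeas.aemeasurable]
    _ ≤ 2 * ∫⁻ y in Metric.closedBall (0 : Fin N → ℝ) (2 * r), κ := by
        gcongr 2 * ?_
        exact setLIntegral_mono' measurableSet_closedBall h
    _ = _ := by rw [setLIntegral_const]

theorem lintegral_mul_volume_large_le {N : ℕ} {f : (Fin N → ℝ) → ℂ} (hf : Continuous f)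
    {E : Set (Fin N → ℝ)} (hE : MeasurableSet E) {δ : ℝ} (hδ : 0 < δ) (r : ℝ) :
    ∫⁻ x, ‖f x‖ₑ ^ 2 * volume ({y | x + y ∈ E ∧ δ * ‖f x‖ ≤ ‖f (x + y)‖} ∩ Metric.closedBall 0 r)
      ≤ ENNReal.ofReal δ⁻¹ ^ 2 * (∫⁻ x in E, ‖f x‖ₑ ^ 2) *
        volume (Metric.closedBall (0 : Fin N → ℝ) r) := by
  set F : (Fin N → ℝ) → ENNReal := E.indicator fun x => ‖f x‖ₑ ^ 2 with hF
  have hFm : Measurable F := (hf.measurable.enorm.pow_const 2).indicator hE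
  have hpt : ∀ x, ‖f x‖ₑ ^ 2 *
      volume ({y | x + y ∈ E ∧ δ * ‖f x‖ ≤ ‖f (x + y)‖} ∩ Metric.closedBall 0 r)
      ≤ ∫⁻ y in Metric.closedBall 0 r, ENNReal.ofReal δ⁻¹ ^ 2 * F (x + y) := by
    intro x
    have hle : MeasurableSet {y | δ * ‖f x‖ ≤ ‖f (x + y)‖} :=
      (isClosed_le (by fun_prop) (by fun_prop)).measurableSet
    have hm : MeasurableSet {y | x + y ∈ E ∧ δ * ‖f x‖ ≤ ‖f (x + y)‖} :=
      (measurable_const_add x hE).inter hle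
    rw [← Measure.restrict_apply hm, ← lintegral_indicator_const hm]
    refine lintegral_mono fun y => ?_
    by_cases hy : y ∈ {y | x + y ∈ E ∧ δ * ‖f x‖ ≤ ‖f (x + y)‖}
    · rw [indicator_of_mem hy, hF, indicator_of_mem hy.1, ← mul_pow]
      gcongr
      rw [← ofReal_norm, ← ofReal_norm, ← ENNReal.ofReal_mul (by positivity)]
      refine ENNReal.ofReal_le_ofReal ?_
      rw [← div_eq_inv_mul, le_div_iff₀ hδ, mul_comm]
      exact hy.2
    · rw [indicator_of_notMem hy]
      exact zero_le
  calc _ ≤ ∫⁻ x, ∫⁻ y in Metric.closedBall 0 r, ENNReal.ofReal δ⁻¹ ^ 2 * F (x + y) :=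
        lintegral_mono hpt
    _ = ∫⁻ y in Metric.closedBall 0 r, ∫⁻ x, ENNReal.ofReal δ⁻¹ ^ 2 * F (x + y) :=
        lintegral_lintegral_swap (by fun_prop)
    _ = ∫⁻ y in Metric.closedBall (0 : Fin N → ℝ) r,
          ENNReal.ofReal δ⁻¹ ^ 2 * ∫⁻ x in E, ‖f x‖ₑ ^ 2 := by
        refine lintegral_congr fun y => ?_
        rw [lintegral_const_mul' _ _ (by finiteness), lintegral_add_right_eq_self F y,
          hF, lintegral_indicator hE]
    _ = _ := by rw [setLIntegral_const]

end Thick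

theorem eLpNorm_two_sq {X : Type*} [MeasurableSpace X] (μ : Measure X) (f : X → ℂ) :
    eLpNorm f 2 μ ^ 2 = ∫⁻ x, ‖f x‖ₑ ^ 2 ∂μ := by
  have := eLpNorm_nnreal_pow_eq_lintegral (f := f) (μ := μ) (p := 2) two_ne_zero
  simp only [NNReal.coe_ofNat, ENNReal.rpow_ofNat] at this
  exact this

theorem exists_volume_cube_eq_ofReal (N : ℕ) {r : ℝ} (hr : 0 < r) :
    ∃ v : ℝ, 0 < v ∧ volume (Metric.closedBall (0 : Fin N → ℝ) r) = ENNReal.ofReal v := by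
  have h1 : volume (Metric.closedBall (0 : Fin N → ℝ) r) ≠ ⊤ := measure_closedBall_lt_top.ne
  refine ⟨_, ENNReal.toReal_pos (Metric.measure_closedBall_pos volume _ hr).ne' h1,
    (ENNReal.ofReal_toReal h1).symm⟩

theorem two_pi_mul_abs_sum_le {N : ℕ} {g : (Fin N → ℝ) → ℂ} {L R : ℝ}
    (hL : 0 ≤ L) (hsupp : Function.support g ⊆ {ξ | ∀ i, |ξ i| ≤ R}) {y : Fin N → ℝ}
    (hy : ‖y‖ ≤ L) (ξ : Fin N → ℝ) (hξ : g ξ ≠ 0) :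
    2 * π * |∑ i, y i * ξ i| ≤ 2 * π * (N * (L * R)) := by
  gcongr
  calc |∑ i, y i * ξ i| ≤ ∑ i, |y i * ξ i| := Finset.abs_sum_le_sum_abs _ _
    _ ≤ ∑ _i : Fin N, L * R := by
        refine Finset.sum_le_sum fun i _ => ?_
        rw [abs_mul]
        exact mul_le_mul ((norm_le_pi_norm y i).trans hy) (hsupp hξ i) (abs_nonneg _) hL
    _ = N * (L * R) := by simp

theorem integrable_of_support_subset_cube {N : ℕ} {g : (Fin N → ℝ) → ℂ} {R : ℝ}
    (hg2 : MemLp g 2) (hsupp : Function.support g ⊆ {ξ | ∀ i, |ξ i| ≤ R}) : Integrable g := by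
  refine memLp_one_iff_integrable.1 (hg2.mono_exponent_of_measure_support_ne_top
    (s := Metric.closedBall 0 |R|) (fun ξ hξ => ?_) measure_closedBall_lt_top.ne one_le_two)
  by_contra h
  refine hξ ((mem_closedBall_zero_iff).2 ((pi_norm_le_iff_of_nonneg (abs_nonneg R)).2 fun i => ?_))
  exact (hsupp h i).trans (le_abs_self R)

/-- Most of the `L²` mass of a band-limited function sits at points `x` such that
`|f (x + y)| ≥ δ |f x|` for most `y` in a given cube. -/
theorem exists_lintegral_mul_volume_small_le {N : ℕ} (hN : 0 < N) {R L c : ℝ} (hR : 0 < R)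
    (hL : 0 < L) (hc : 0 < c) :
    ∃ δ : ℝ, 0 < δ ∧ ∀ g : (Fin N → ℝ) → ℂ, MemLp g 2 →
      Function.support g ⊆ {ξ | ∀ i, |ξ i| ≤ R} →
      ∫⁻ x, ‖fourierSynthesis g x‖ₑ ^ 2 * volume
          ({y | ‖fourierSynthesis g (x + y)‖ < δ * ‖fourierSynthesis g x‖} ∩
            Metric.closedBall 0 (L / 2))
        ≤ ENNReal.ofReal c * ∫⁻ x, ‖fourierSynthesis g x‖ₑ ^ 2 := by
  obtain ⟨v, hv, hvol⟩ := exists_volume_cube_eq_ofReal N (by positivity : 0 < 2 * (L / 2))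
  obtain ⟨δ, hδ, hmass⟩ := exists_lintegral_mul_volume_sublevel_expSeries_le
    (B := 2 * π * (N * (L * R))) (θ := c / (4 * v)) (by positivity) (by positivity)
  refine ⟨δ, hδ, fun g hg2 hsupp => ?_⟩
  have hg := integrable_of_support_subset_cube hg2 hsupp
  refine (lintegral_mul_volume_small_le (continuous_fourierSynthesis hg) δ (L / 2)
    (κ := ENNReal.ofReal (2 * (c / (4 * v))) * ∫⁻ x, ‖fourierSynthesis g x‖ₑ ^ 2)
    fun y hy => ?_).trans_eq ?_
  · rw [mem_closedBall_zero_iff, mul_div_cancel₀ _ two_ne_zero] at hy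
    have hB := two_pi_mul_abs_sum_le hL.le hsupp hy
    have h := hmass volume (fun k => fourierSynthesis fun ξ =>
      g ξ * (2 * π * Complex.I * ((∑ i, y i * ξ i : ℝ) : ℂ)) ^ k)
      (fun k => (continuous_fourierSynthesis
        (integrable_mul_two_pi_I_sum_pow hg hB k)).measurable.aemeasurable)
      (fun k => by
        rw [← eLpNorm_two_sq, ← eLpNorm_two_sq, ← mul_pow]
        gcongr
        simpa using eLpNorm_fourierSynthesis_mul_pow_le hg hg2 hB k)
    simp_rw [← fourierSynthesis_add_smul hg hB, pow_zero, mul_one] at h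
    exact h
  · rw [hvol, mul_right_comm, ← mul_assoc, ← ENNReal.ofReal_mul (by positivity),
      ← ENNReal.ofReal_ofNat 2, ← ENNReal.ofReal_mul (by positivity)]
    congr 2
    field_simp
    norm_num

/-- The Logvinenko–Sereda / Kovrijkine inequality: if `E ⊆ ℝ^N` is a thick measurable set
and `R > 0`, then there is `C > 0` such that every `L²` function `f` whose Fourier
transform `g` is supported in the cube `[-R,R]^N` satisfies
`‖f‖_{L²(ℝ^N)} ≤ C ‖f‖_{L²(E)}`. -/
theorem logvinenko_sereda_kovrijkine
    {N : ℕ} (hN : 0 < N) (E : Set (Fin N → ℝ)) (hE : MeasurableSet E)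
    (hthick : ∃ ε : ℝ, 0 < ε ∧ ∃ L : ℝ, 0 < L ∧ ∀ x : Fin N → ℝ,
      ENNReal.ofReal (ε * L ^ N) ≤ volume (E ∩ {y | ∀ i, |y i - x i| ≤ L / 2}))
    (R : ℝ) (hR : 0 < R) :
    ∃ C : ℝ, 0 < C ∧ ∀ g : (Fin N → ℝ) → ℂ,
      MemLp g 2 volume →
      (Function.support g ⊆ {ξ | ∀ i, |ξ i| ≤ R}) →
      eLpNorm (fun x : Fin N → ℝ => ∫ ξ : Fin N → ℝ, g ξ *
          Complex.exp (2 * π * Complex.I * ((∑ i, x i * ξ i : ℝ) : ℂ))) 2 volume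
        ≤ ENNReal.ofReal C *
          eLpNorm (fun x : Fin N → ℝ => ∫ ξ : Fin N → ℝ, g ξ *
            Complex.exp (2 * π * Complex.I * ((∑ i, x i * ξ i : ℝ) : ℂ)))
            2 (volume.restrict E) := by
  obtain ⟨ε, hε, L, hL, hthick⟩ := hthick
  set c : ℝ := ε * L ^ N with hc
  have hc0 : 0 < c := by positivity
  obtain ⟨δ, hδ, hsmall⟩ := exists_lintegral_mul_volume_small_le hN hR hL (half_pos hc0)
  obtain ⟨q, hq, hvol⟩ := exists_volume_cube_eq_ofReal N (half_pos hL)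
  refine ⟨δ⁻¹ * √(q * (2 / c)), by positivity, fun g hg2 hsupp => ?_⟩
  have hg := integrable_of_support_subset_cube hg2 hsupp
  change eLpNorm (fourierSynthesis g) 2 volume
    ≤ _ * eLpNorm (fourierSynthesis g) 2 (volume.restrict E)
  set f := fourierSynthesis g with hf
  have hfc : Continuous f := continuous_fourierSynthesis hg
  set W := ∫⁻ x, ‖f x‖ₑ ^ 2 with hW
  set WE := ∫⁻ x in E, ‖f x‖ₑ ^ 2 with hWE
  have hWtop : W ≠ ⊤ := by
    rw [hW, ← eLpNorm_two_sq, hf, eLpNorm_fourierSynthesis hg hg2]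
    exact ENNReal.pow_ne_top hg2.2.ne
  have hcube : ∀ x, ENNReal.ofReal c ≤
      volume ({y | ‖f (x + y)‖ < δ * ‖f x‖} ∩ Metric.closedBall 0 (L / 2)) +
      volume ({y | x + y ∈ E ∧ δ * ‖f x‖ ≤ ‖f (x + y)‖} ∩ Metric.closedBall 0 (L / 2)) := by
    intro x
    refine ((hthick x).trans_eq (measure_preimage_add volume x _).symm).trans
      ((measure_mono ?_).trans (measure_union_le _ _))
    rintro y ⟨hyE, hy⟩
    have hyQ : y ∈ Metric.closedBall (0 : Fin N → ℝ) (L / 2) := by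
      rw [mem_closedBall_zero_iff, pi_norm_le_iff_of_nonneg (half_pos hL).le]
      intro i
      simpa using hy i
    rcases lt_or_ge ‖f (x + y)‖ (δ * ‖f x‖) with h | h
    · exact Or.inl ⟨h, hyQ⟩
    · exact Or.inr ⟨⟨hyE, h⟩, hyQ⟩
  have hmeas : Measurable fun x => ‖f x‖ₑ ^ 2 *
      volume ({y | ‖f (x + y)‖ < δ * ‖f x‖} ∩ Metric.closedBall 0 (L / 2)) := by
    refine (hfc.measurable.enorm.pow_const 2).mul ?_
    have hm : MeasurableSet {p : (Fin N → ℝ) × (Fin N → ℝ) | ‖f (p.1 + p.2)‖ < δ * ‖f p.1‖} :=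
      (isOpen_lt (by fun_prop) (by fun_prop)).measurableSet
    exact measurable_measure_prodMk_left (hm.inter (measurable_snd measurableSet_closedBall))
  have hsplit : ENNReal.ofReal c * W ≤ ENNReal.ofReal (c / 2) * W +
      ENNReal.ofReal δ⁻¹ ^ 2 * WE * ENNReal.ofReal q := by
    calc ENNReal.ofReal c * W = ∫⁻ x, ‖f x‖ₑ ^ 2 * ENNReal.ofReal c := by
          rw [lintegral_mul_const' _ _ (by finiteness), mul_comm]
      _ ≤ _ := lintegral_mono fun x => mul_le_mul_right (hcube x) _
      _ = _ := by simp_rw [mul_add]; exact lintegral_add_left hmeas _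
      _ ≤ _ := add_le_add (hsmall g hg2 hsupp)
          ((lintegral_mul_volume_large_le hfc hE hδ (L / 2)).trans_eq (by rw [hvol]))
  have hhalf : ENNReal.ofReal (c / 2) * W ≤ ENNReal.ofReal δ⁻¹ ^ 2 * WE * ENNReal.ofReal q := by
    have h2 : ENNReal.ofReal c = ENNReal.ofReal (c / 2) + ENNReal.ofReal (c / 2) := by
      rw [← ENNReal.ofReal_add (by positivity) (by positivity), add_halves]
    rw [h2, add_mul] at hsplit
    exact (ENNReal.add_le_add_iff_left (by finiteness)).1 hsplit
  refine (ENNReal.pow_le_pow_left_iff two_ne_zero).1 ?_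
  rw [mul_pow, eLpNorm_two_sq, eLpNorm_two_sq, ENNReal.ofReal_mul (by positivity), mul_pow,
    ← ENNReal.ofReal_pow (Real.sqrt_nonneg _), Real.sq_sqrt (by positivity),
    ENNReal.ofReal_mul hq.le]
  calc W = ENNReal.ofReal (2 / c) * (ENNReal.ofReal (c / 2) * W) := by
        rw [← mul_assoc, ← ENNReal.ofReal_mul (by positivity), div_mul_div_cancel₀ hc0.ne',
          div_self two_ne_zero, ENNReal.ofReal_one, one_mul]
    _ ≤ ENNReal.ofReal (2 / c) * (ENNReal.ofReal δ⁻¹ ^ 2 * WE * ENNReal.ofReal q) := by gcongr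
    _ = _ := by ring
end
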